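/- arXiv:2210.17282 — 2 statements merged into one kernel-verified Lean document; each statement's English description precedes it below -/
import Mathlib

section
/- Let s ≥ 2 and let m₁, …, m_s be integers with m_i > 1 for all i. Set G = ℤ_{m₁} * ⋯ * ℤ_{m_s} and m = lcm(m₁, …, m_s). Let cm : G → ℤ_m be the group homomorphism determined by sending a fixed generator of the i-th free factor ℤ_{m_i} to (m/m_i)·g, where g is a fixed generator of ℤ_m. Then cm is surjective, and its kernel is isomorphic to a free group 𝔽_ρ of rank ρ = 1 − m + Σ_{i=1}^{s} (m − m/m_i), i.e. ρ = 1 − m + m·Σ_{i=1}^{s} (1 − 1/m_i). -/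
noncomputable section

namespace KerFree

open CategoryTheory CategoryTheory.ActionCategory Monoid

/-- Functors from a connected groupoid to a group. -/
theorem functor_card {C : Type} [Groupoid.{0} C] (r : C) (hc : ∀ a : C, Nonempty (r ⟶ a))
    (X : Type) [Group X] :
    Nonempty ((C ⥤ SingleObj X) ≃ (End r →* X) × ({a : C // a ≠ r} → X)) := by
  classical
  obtain ⟨t, ht⟩ : ∃ t : ∀ a : C, r ⟶ a, t r = 𝟙 r := by
    refine ⟨fun a => if h : a = r then eqToHom h.symm else (hc a).some, ?_⟩
    simp
  have mc : ∀ (F : C ⥤ SingleObj X) {a b c : C} (f : a ⟶ b) (g : b ⟶ c),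
      (F.map (f ≫ g) : X) = (F.map g : X) * (F.map f : X) := fun F a b c f g => F.map_comp f g
  have mi : ∀ (F : C ⥤ SingleObj X) (a : C), (F.map (𝟙 a) : X) = 1 := fun F a => F.map_id a
  have minv : ∀ (F : C ⥤ SingleObj X) {a b : C} (f : a ⟶ b),
      (F.map (Groupoid.inv f) : X) = (F.map f : X)⁻¹ := by
    intro F a b f
    rw [eq_inv_iff_mul_eq_one, ← mc, Groupoid.comp_inv, mi]
  let toF : (C ⥤ SingleObj X) → (End r →* X) × ({a : C // a ≠ r} → X) := fun F =>
    (⟨⟨fun x => (F.map x : X), mi F r⟩, fun x y => mc F y x⟩, fun a => (F.map (t a) : X))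
  let ext : ({a : C // a ≠ r} → X) → C → X := fun p a => if h : a = r then 1 else p ⟨a, h⟩
  let loop : ∀ {a b : C} (f : a ⟶ b), End r := fun {a b} f => t a ≫ f ≫ Groupoid.inv (t b)
  have loop_id : ∀ a : C, loop (𝟙 a) = 1 := by
    intro a
    change t a ≫ 𝟙 a ≫ Groupoid.inv (t a) = 𝟙 r
    simp
  have loop_comp : ∀ {a b c : C} (f : a ⟶ b) (g : b ⟶ c), loop (f ≫ g) = loop g * loop f := by
    intro a b c f g
    change t a ≫ (f ≫ g) ≫ Groupoid.inv (t c) =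
      (t a ≫ f ≫ Groupoid.inv (t b)) ≫ (t b ≫ g ≫ Groupoid.inv (t c))
    simp
  let invF : (End r →* X) × ({a : C // a ≠ r} → X) → (C ⥤ SingleObj X) := fun q =>
    { obj := fun _ => ()
      map := fun {a b} f => (ext q.2 b * q.1 (loop f) * (ext q.2 a)⁻¹ : X)
      map_id := by
        intro a
        change (ext q.2 a * q.1 (loop (𝟙 a)) * (ext q.2 a)⁻¹ : X) = 1
        rw [loop_id, map_one, mul_one, mul_inv_cancel]
      map_comp := by
        intro a b c f g
        change (ext q.2 c * q.1 (loop (f ≫ g)) * (ext q.2 a)⁻¹ : X) =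
          (ext q.2 c * q.1 (loop g) * (ext q.2 b)⁻¹) * (ext q.2 b * q.1 (loop f) * (ext q.2 a)⁻¹)
        rw [loop_comp, map_mul]; group }
  have ext_r : ∀ p, ext p r = 1 := fun p => by simp [ext]
  refine ⟨⟨toF, invF, ?_, ?_⟩⟩
  · intro F
    have hext : ∀ a, ext (toF F).2 a = (F.map (t a) : X) := by
      intro a
      by_cases h : a = r
      · subst h; rw [ext_r, ht, mi]
      · simp [ext, h, toF]
    apply Functor.hext
    · intro a; rfl
    · intro a b f
      apply heq_of_eq
      change (ext (toF F).2 b * (F.map (loop f) : X) * (ext (toF F).2 a)⁻¹ : X) = F.map f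
      rw [hext, hext]
      change _ * (F.map (t a ≫ f ≫ Groupoid.inv (t b)) : X) * _ = _
      rw [mc, mc, minv]
      group
  · rintro ⟨φ, p⟩
    apply Prod.ext
    · ext x
      change ext p r * φ (loop x) * (ext p r)⁻¹ = φ x
      have : loop (show r ⟶ r from x) = x := by
        change t r ≫ (show r ⟶ r from x) ≫ Groupoid.inv (t r) = x
        rw [ht]; simp
      rw [ext_r, this]; simp
    · funext a
      change ext p a * φ (loop (t a)) * (ext p r)⁻¹ = p a
      have : loop (t a) = 1 := by
        change t r ≫ t a ≫ Groupoid.inv (t a) = 𝟙 r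
        rw [ht]; simp
      rw [ext_r, this, map_one]
      simp [ext, a.2]

theorem rank_end {C : Type} [Groupoid.{0} C] [IsConnected C] [IsFreeGroupoid C] [Finite C] (r : C)
    {S : Type} [Finite S] (E2 : (C ⥤ SingleObj (Multiplicative (ZMod 2))) ≃
      (S → Multiplicative (ZMod 2))) :
    ∃ ρ : ℕ, ρ + Nat.card C = 1 + Nat.card S ∧ Nonempty (End r ≃* FreeGroup (Fin ρ)) := by
  classical
  have hfree : IsFreeGroup (End r) := inferInstance
  obtain ⟨κ, ⟨B⟩⟩ := hfree.nonempty_basis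
  let X := Multiplicative (ZMod 2)
  have hX : Nat.card X = 2 := by simp [X]
  obtain ⟨E1⟩ := functor_card r (fun a => nonempty_hom_of_preconnected_groupoid r a) X
  let E3 : (κ → X) ≃ (End r →* X) := B.lift
  let E4 : (S → X) ≃ (κ → X) × ({a : C // a ≠ r} → X) :=
    E2.symm.trans (E1.trans (Equiv.prodCongr E3.symm (Equiv.refl _)))
  have : Finite X := Nat.finite_of_card_ne_zero (by rw [hX]; norm_num)
  have : Finite ((κ → X) × ({a : C // a ≠ r} → X)) := Finite.of_equiv _ E4
  have : Finite (κ → X) := Finite.of_surjective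
    (Prod.fst : (κ → X) × ({a : C // a ≠ r} → X) → _) Prod.fst_surjective
  have : Finite κ := by
    refine Finite.of_injective (fun k : κ => fun k' => if k = k' then
      (Multiplicative.ofAdd (1 : ZMod 2) : X) else 1) ?_
    intro k k' h
    have h1 := congrFun h k'
    by_contra hne
    simp only [if_neg hne] at h1
    exact absurd h1 (by decide)
  have hcard := Nat.card_congr E4
  rw [Nat.card_prod, Nat.card_fun, Nat.card_fun, Nat.card_fun, hX, ← pow_add] at hcard
  have hcard' := Nat.pow_right_injective le_rfl hcard
  have hV : Nat.card {a : C // a ≠ r} + 1 = Nat.card C := by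
    have := Nat.card_congr (Equiv.sumCompl (fun a : C => a = r))
    rw [Nat.card_sum] at this
    have h1 : Nat.card {a : C // a = r} = 1 := by simp
    rw [h1] at this
    change Nat.card {a : C // ¬ (a = r)} + 1 = _
    omega
  refine ⟨Nat.card κ, ?_, ⟨B.repr.trans (FreeGroup.freeGroupCongr (Finite.equivFin κ))⟩⟩
  omega

variable {ι : Type} {H : ι → Type} [∀ i, Group (H i)] {A : Type} [MulAction (CoprodI H) A]

/-- Representatives of the orbits of the free factors. -/
structure Reps (H : ι → Type) [∀ i, Group (H i)] (A : Type) [MulAction (CoprodI H) A] where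
  rep : ι → A → A
  kap : ∀ i, A → H i
  kap_smul : ∀ i a, (CoprodI.of (kap i a) : CoprodI H) • rep i a = a
  rep_smul : ∀ i (h : H i) a, rep i ((CoprodI.of h : CoprodI H) • a) = rep i a
  free : ∀ i (h h' : H i) (a : A), (CoprodI.of h : CoprodI H) • a =
    (CoprodI.of h' : CoprodI H) • a → h = h'

theorem Reps.nonempty_of_free (free : ∀ i (h h' : H i) (a : A), (CoprodI.of h : CoprodI H) • a =
    (CoprodI.of h' : CoprodI H) • a → h = h') : Nonempty (Reps H A) := by
  classical
  let S : ι → Setoid A := fun i =>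
    { r := fun a b => ∃ h : H i, (CoprodI.of h : CoprodI H) • a = b
      iseqv := ⟨fun a => ⟨1, by simp⟩, fun {a b} ⟨h, e⟩ => ⟨h⁻¹, by simp [← e]⟩,
        fun {a b c} ⟨h, e⟩ ⟨h', e'⟩ => ⟨h' * h, by simp [mul_smul, e, e']⟩⟩ }
  have key : ∀ i a, ∃ h : H i,
      (CoprodI.of h : CoprodI H) • (Quotient.out (Quotient.mk (S i) a)) = a :=
    fun i a => Quotient.exact (s := S i) (Quotient.out_eq (Quotient.mk (S i) a))
  choose k hk using key
  exact ⟨⟨fun i a => Quotient.out (Quotient.mk (S i) a), k, hk, fun i h a =>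
    congrArg Quotient.out (Quotient.sound (s := S i) ⟨h⁻¹, by simp⟩), free⟩⟩

theorem Reps.rep_rep (R : Reps H A) (i : ι) (a : A) : R.rep i (R.rep i a) = R.rep i a := by
  conv_rhs => rw [← R.kap_smul i a, R.rep_smul]

theorem Reps.kap_eq (R : Reps H A) (i : ι) (a : A) (h : H i)
    (e : (CoprodI.of h : CoprodI H) • R.rep i a = a) : R.kap i a = h :=
  R.free i _ _ (R.rep i a) ((R.kap_smul i a).trans e.symm)

theorem Reps.kap_smul' (R : Reps H A) (i : ι) (a : A) (h : H i) :
    R.kap i ((CoprodI.of h : CoprodI H) • a) = h * R.kap i a := by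
  apply R.kap_eq
  rw [R.rep_smul, map_mul, mul_smul, R.kap_smul]

/-- The free groupoid structure of the action groupoid. -/
@[reducible]
def Reps.isFree (R : Reps H A) : IsFreeGroupoid (ActionCategory (CoprodI H) A) where
  quiverGenerators :=
    ⟨fun a b => { i : ι // R.rep i b.back ≠ b.back ∧ R.rep i b.back = a.back }⟩
  of := fun {a b} e => ⟨CoprodI.of (R.kap e.1 b.back), by
    have h1 := R.kap_smul e.1 b.back
    rw [e.2.2] at h1
    exact h1⟩
  unique_lift := by
    classical
    intro X _ f
    let p : ι → A → X := fun i b =>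
      if h : R.rep i b = b then 1 else @f ⟨(), R.rep i b⟩ ⟨(), b⟩ ⟨i, h, rfl⟩
    have p_rep : ∀ i b, p i (R.rep i b) = 1 := fun i b => dif_pos (R.rep_rep i b)
    let hom : ∀ i, H i →* (A → X) ⋊[mulAutArrow] (CoprodI H) := fun i =>
      { toFun := fun h => ⟨fun b => p i b * (p i ((CoprodI.of h : CoprodI H)⁻¹ • b))⁻¹,
          CoprodI.of h⟩
        map_one' := by
          ext b
          · simp
          · simp
        map_mul' := by
          intro g h
          ext b
          · change p i b * (p i ((CoprodI.of (g * h) : CoprodI H)⁻¹ • b))⁻¹ =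
              (p i b * (p i ((CoprodI.of g : CoprodI H)⁻¹ • b))⁻¹) *
              (p i ((CoprodI.of g : CoprodI H)⁻¹ • b) * (p i ((CoprodI.of h : CoprodI H)⁻¹ •
                ((CoprodI.of g : CoprodI H)⁻¹ • b)))⁻¹)
            rw [map_mul, mul_inv_rev, mul_smul]
            group
          · simp }
    let F' := CoprodI.lift hom
    have hF' : ∀ i h, F' (CoprodI.of h) = hom i h := fun i h => CoprodI.lift_of hom h
    have sane : ∀ g, (F' g).right = g := by
      suffices SemidirectProduct.rightHom.comp F' = MonoidHom.id _ by
        exact DFunLike.ext_iff.mp this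
      apply CoprodI.ext_hom
      intro i
      ext h
      simp only [MonoidHom.comp_apply, hF']
      rfl
    refine ⟨uncurry F' sane, ?_, ?_⟩
    · rintro ⟨⟨⟩, a : A⟩ ⟨⟨⟩, b : A⟩ ⟨i, h1 : R.rep i b ≠ b, h2 : R.rep i b = a⟩
      subst h2
      change (F' (CoprodI.of (R.kap i b))).left b = _
      rw [hF']
      change p i b * (p i ((CoprodI.of (R.kap i b) : CoprodI H)⁻¹ • b))⁻¹ = _
      rw [inv_smul_eq_iff.mpr (R.kap_smul i b).symm, p_rep]
      simp only [inv_one, mul_one]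
      exact dif_neg h1
    · intro E hE
      have : curry E = F' := by
        apply CoprodI.ext_hom
        intro i
        ext h
        · rename_i b
          rw [MonoidHom.comp_apply, MonoidHom.comp_apply, hF']
          change (E.map (homOfPair b (CoprodI.of h)) : X) =
            p i b * (p i ((CoprodI.of h : CoprodI H)⁻¹ • b))⁻¹
          have Eeq : ∀ {a a' b : ActionCategory (CoprodI H) A} (f : a ⟶ b) (f' : a' ⟶ b),
              a = a' → f.val = f'.val → (E.map f : X) = E.map f' := by
            intro a a' b f f' ha hf
            subst ha
            rw [Subtype.ext hf]
          let o : A → ActionCategory (CoprodI H) A := fun a => ⟨(), a⟩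
          have Eedge : ∀ (b : A) (f : o (R.rep i b) ⟶ o b),
              f.val = CoprodI.of (R.kap i b) → (E.map f : X) = p i b := by
            intro b f hf
            by_cases hb : R.rep i b = b
            · have h1 : R.kap i b = 1 := R.kap_eq i b 1 (by simp [hb])
              rw [h1, map_one] at hf
              rw [Eeq f (𝟙 _) (by rw [hb]) hf]
              rw [show p i b = 1 from dif_pos hb]
              exact E.map_id _
            · have h3 := hE (show ActionCategory (CoprodI H) A from ⟨(), R.rep i b⟩)
                (show ActionCategory (CoprodI H) A from ⟨(), b⟩) ⟨i, hb, rfl⟩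
              rw [show p i b = _ from dif_neg hb, ← h3]
              exact Eeq _ _ rfl hf
          let c : A := (CoprodI.of h : CoprodI H)⁻¹ • b
          have hcb : (CoprodI.of h : CoprodI H) • c = b := smul_inv_smul _ b
          have hrep : R.rep i c = R.rep i b := by rw [← hcb, R.rep_smul]
          have hkap : R.kap i b = h * R.kap i c := by rw [← hcb, R.kap_smul']
          let ec : o (R.rep i c) ⟶ o c :=
            ⟨CoprodI.of (R.kap i c), R.kap_smul i c⟩
          let eb : o (R.rep i b) ⟶ o b :=
            ⟨CoprodI.of (R.kap i b), R.kap_smul i b⟩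
          let hc : o c ⟶ o b :=
            homOfPair b (CoprodI.of h)
          have h5 : (E.map (ec ≫ hc) : X) = E.map eb := by
            apply Eeq
            · rw [hrep]
            · change CoprodI.of h * CoprodI.of (R.kap i c) = CoprodI.of (R.kap i b)
              rw [hkap, map_mul]
          have h6 : (E.map (ec ≫ hc) : X) = (E.map hc : X) * (E.map ec : X) := E.map_comp ec hc
          rw [h6, Eedge b eb rfl, Eedge c ec rfl] at h5
          exact eq_mul_inv_of_mul_eq h5
        · simp only [MonoidHom.comp_apply, hF']
          rfl
      apply Functor.hext
      · intro
        apply Unit.ext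
      · refine ActionCategory.cases ?_
        intro t g
        apply heq_of_eq
        change _ = (F' g).left t
        rw [← this]
        rfl


theorem Reps.labelling (R : Reps H A) (X : Type) [Group X] :
    Nonempty ((ActionCategory (CoprodI H) A ⥤ SingleObj X) ≃
      ((Σ i, {b : A // R.rep i b ≠ b}) → X)) := by
  let _ := R.isFree
  let lab : ((Σ i, {b : A // R.rep i b ≠ b}) → X) →
      Quiver.Labelling (IsFreeGroupoid.Generators (ActionCategory (CoprodI H) A)) X :=
    fun f a b e => f ⟨e.1, ActionCategory.back b, e.2.1⟩
  let o : A → ActionCategory (CoprodI H) A := fun a => ⟨(), a⟩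
  let edge : ∀ e : (Σ i, {b : A // R.rep i b ≠ b}), o (R.rep e.1 e.2.1) ⟶ o e.2.1 :=
    fun e => ⟨CoprodI.of (R.kap e.1 e.2.1), R.kap_smul e.1 e.2.1⟩
  let Φ : (ActionCategory (CoprodI H) A ⥤ SingleObj X) →
      ((Σ i, {b : A // R.rep i b ≠ b}) → X) := fun F e => (F.map (edge e) : X)
  have key : ∀ F f, (∀ (a b : IsFreeGroupoid.Generators (ActionCategory (CoprodI H) A))
      (g : a ⟶ b), F.map (IsFreeGroupoid.of g) = lab f g) ↔ Φ F = f := by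
    intro F f
    constructor
    · intro h
      funext e
      exact h (o (R.rep e.1 e.2.1)) (o e.2.1) ⟨e.1, e.2.2, rfl⟩
    · rintro rfl
      rintro ⟨⟨⟩, a : A⟩ ⟨⟨⟩, b : A⟩ ⟨i, h1 : R.rep i b ≠ b, h2 : R.rep i b = a⟩
      subst h2
      rfl
  refine ⟨Equiv.ofBijective Φ ?_⟩
  rw [Function.bijective_iff_existsUnique]
  intro f
  obtain ⟨F, h1, h2⟩ := IsFreeGroupoid.unique_lift (lab f)
  exact ⟨F, (key F f).1 h1, fun F' h => h2 F' ((key F' f).2 h)⟩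

theorem Reps.card (R : Reps H A) (i : ι) :
    Nat.card (H i) * Nat.card {b : A // R.rep i b = b} = Nat.card A := by
  rw [← Nat.card_prod]
  refine Nat.card_congr
    { toFun := fun x => (CoprodI.of x.1 : CoprodI H) • x.2.1
      invFun := fun a => (R.kap i a, ⟨R.rep i a, R.rep_rep i a⟩)
      left_inv := ?_
      right_inv := fun a => R.kap_smul i a }
  rintro ⟨h, b, hb⟩
  have h1 : R.kap i b = 1 := R.kap_eq i b 1 (by simp [hb])
  ext
  · simp [R.kap_smul', h1]
  · simp [R.rep_smul, hb]

theorem ker_free [Fintype ι] [∀ i, Finite (H i)] {A : Type} [Group A] [Finite A]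
    (cm : CoprodI H →* A) (hsurj : Function.Surjective cm)
    (hinj : ∀ i (h : H i), cm (CoprodI.of h) = 1 → h = 1) :
    ∃ ρ : ℕ, (ρ : ℤ) = 1 - (Nat.card A : ℤ) +
      ∑ i, ((Nat.card A : ℤ) - ((Nat.card A / Nat.card (H i) : ℕ) : ℤ)) ∧
        Nonempty (cm.ker ≃* FreeGroup (Fin ρ)) := by
  classical
  let _ : MulAction (CoprodI H) A := MulAction.compHom A cm
  have smul_def : ∀ (g : CoprodI H) (a : A), g • a = cm g * a := fun _ _ => rfl
  have : MulAction.IsPretransitive (CoprodI H) A := ⟨fun a b => by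
    obtain ⟨g, hg⟩ := hsurj (b * a⁻¹)
    exact ⟨g, by simp [smul_def, hg]⟩⟩
  obtain ⟨R⟩ := Reps.nonempty_of_free (H := H) (A := A) (by
    intro i h h' a e
    simp only [smul_def] at e
    have e1 := mul_right_cancel e
    rw [← inv_mul_eq_one]
    apply hinj i
    simp [e1])
  let r : ActionCategory (CoprodI H) A := ⟨(), (1 : A)⟩
  have hstab : MulAction.stabilizer (CoprodI H) (1 : A) = cm.ker := by
    ext g
    simp [MulAction.mem_stabilizer_iff, smul_def, MonoidHom.mem_ker]
  let e1 : cm.ker ≃* End r :=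
    (MulEquiv.subgroupCongr hstab.symm).trans (stabilizerIsoEnd (CoprodI H) (1 : A))
  let _ := R.isFree
  have hconn : IsConnected (ActionCategory (CoprodI H) A) := inferInstance
  obtain ⟨E2⟩ := R.labelling (Multiplicative (ZMod 2))
  have hA : Nat.card (ActionCategory (CoprodI H) A) = Nat.card A :=
    Nat.card_congr (objEquiv (CoprodI H) A).symm
  have : Finite (ActionCategory (CoprodI H) A) := Finite.of_equiv _ (objEquiv (CoprodI H) A)
  obtain ⟨ρ, hcard', ⟨e2⟩⟩ := @rank_end _ _ hconn _ _ r _ _ E2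
  rw [hA] at hcard'
  have hE : ∀ i, (Nat.card {b : A // R.rep i b ≠ b} : ℤ) =
      (Nat.card A : ℤ) - ((Nat.card A / Nat.card (H i) : ℕ) : ℤ) := by
    intro i
    have := Nat.card_congr (Equiv.sumCompl (fun b : A => R.rep i b = b))
    rw [Nat.card_sum] at this
    have h1 : Nat.card A / Nat.card (H i) = Nat.card {b : A // R.rep i b = b} := by
      rw [← R.card i, Nat.mul_div_cancel_left _ Nat.card_pos]
    rw [h1]
    change (Nat.card {b : A // ¬ (R.rep i b = b)} : ℤ) = _
    omega
  refine ⟨ρ, ?_, ⟨e1.trans e2⟩⟩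
  rw [Nat.card_sigma] at hcard'
  rw [← Finset.sum_congr rfl (fun i _ => hE i), ← Nat.cast_sum]
  omega

end KerFree

theorem stmt_3 (s : ℕ) (hs : 2 ≤ s) (m : Fin s → ℕ) (hm : ∀ i, 1 < m i)
    (M : ℕ) (hM : M = Finset.univ.lcm m)
    (cm : Monoid.CoprodI (fun i : Fin s => Multiplicative (ZMod (m i))) →*
      Multiplicative (ZMod M))
    (hcm : ∀ i : Fin s,
      cm (Monoid.CoprodI.of (Multiplicative.ofAdd (1 : ZMod (m i)))) =
        Multiplicative.ofAdd ((M / m i : ℕ) : ZMod M)) :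
    Function.Surjective cm ∧
      ∃ ρ : ℕ, (ρ : ℤ) = 1 - (M : ℤ) + ∑ i : Fin s, ((M : ℤ) - ((M / m i : ℕ) : ℤ)) ∧
        Nonempty (cm.ker ≃* FreeGroup (Fin ρ)) := by
  have hM0 : M ≠ 0 := by
    rw [hM]
    intro h
    rw [Finset.lcm_eq_zero_iff] at h
    obtain ⟨i, _, hi⟩ := h
    have := hm i
    omega
  have : NeZero M := ⟨hM0⟩
  have : ∀ i, NeZero (m i) := fun i => ⟨by have := hm i; omega⟩
  have hdvd : ∀ i, m i ∣ M := fun i => hM ▸ Finset.dvd_lcm (Finset.mem_univ i)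
  have hmul : ∀ i, m i * (M / m i) = M := fun i => Nat.mul_div_cancel' (hdvd i)
  have hcm' : ∀ (i : Fin s) (k : ℕ),
      cm (Monoid.CoprodI.of (Multiplicative.ofAdd (k : ZMod (m i)))) =
        Multiplicative.ofAdd ((k * (M / m i) : ℕ) : ZMod M) := by
    intro i k
    have h1 : (Multiplicative.ofAdd (k : ZMod (m i))) = (Multiplicative.ofAdd (1 : ZMod (m i))) ^ k := by
      rw [← ofAdd_nsmul, nsmul_one]
    rw [h1, map_pow, map_pow, hcm, ← ofAdd_nsmul, nsmul_eq_mul]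
    push_cast
    rfl
  have hinj : ∀ (i : Fin s) (h : Multiplicative (ZMod (m i))),
      cm (Monoid.CoprodI.of h) = 1 → h = 1 := by
    intro i h hh
    have hk : h = Multiplicative.ofAdd (((Multiplicative.toAdd h).val : ℕ) : ZMod (m i)) := by
      rw [ZMod.natCast_zmod_val]; rfl
    rw [hk, hcm', ofAdd_eq_one, ZMod.natCast_eq_zero_iff] at hh
    have hpos : 0 < M / m i := Nat.div_pos (Nat.le_of_dvd (by omega) (hdvd i)) (by have := hm i; omega)
    nth_rewrite 1 [← hmul i] at hh
    have h2 := Nat.dvd_of_mul_dvd_mul_right hpos hh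
    rw [hk, ofAdd_eq_one, ZMod.natCast_eq_zero_iff]
    exact h2
  have hsurj : Function.Surjective cm := by
    have hrange : Nat.card cm.range = M := by
      apply Nat.dvd_antisymm
      · have := Subgroup.card_subgroup_dvd_card cm.range
        simpa using this
      · nth_rewrite 1 [hM]
        apply Finset.lcm_dvd
        intro i _
        let f : Multiplicative (ZMod (m i)) →* cm.range := cm.rangeRestrict.comp
          (Monoid.CoprodI.of (M := fun i : Fin s => Multiplicative (ZMod (m i))) (i := i))
        have hf : Function.Injective f := by
          rw [injective_iff_map_eq_one]
          intro h hh
          exact hinj i h (congrArg Subtype.val hh)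
        have := Subgroup.card_dvd_of_injective f hf
        simpa using this
    rw [← MonoidHom.range_eq_top]
    apply Subgroup.eq_top_of_card_eq
    rw [hrange]
    simp
  refine ⟨hsurj, ?_⟩
  have := KerFree.ker_free cm hsurj hinj
  simpa using this
end
end

section
/- Let f ∈ ℂ[x,y] be a nonconstant polynomial which is primitive in the sense that its generic fibers are connected, i.e., there is a finite set A₀ ⊆ ℂ such that f⁻¹(c) ⊆ ℂ² is connected for all c ∈ ℂ \ A₀. Then there exists a finite set A ⊆ ℂ such that for every r ≥ 1 and every choice of r distinct values c₁, …, c_r ∈ ℂ \ A, the fundamental group of the complement of the union of the corresponding fibers satisfies π₁(ℂ² \ ⋃_{i=1}^{r} f⁻¹(c_i)) ≅ 𝔽_r. -/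
open MvPolynomial

noncomputable section

open CategoryTheory in
/-- The class `e` contains a path that stays in `V`. -/
def InV {X : Type*} [TopologicalSpace X] (V : Set X) {a b : X}
    (e : FundamentalGroupoid.mk a ⟶ FundamentalGroupoid.mk b) : Prop :=
  ∃ p : Path a b, (∀ t, p t ∈ V) ∧ e = Path.Homotopic.Quotient.mk p

/-- `V` is path connected and any two paths of `V` with the same ends are homotopic in `X`. -/
def PCon {X : Type*} [TopologicalSpace X] (V : Set X) : Prop :=
  (∀ a ∈ V, ∀ b ∈ V, JoinedIn V a b) ∧
    ∀ (a b : X) (p q : Path a b), (∀ t, p t ∈ V) → (∀ t, q t ∈ V) → p.Homotopic q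

section vk
open CategoryTheory
variable {X : Type*} [TopologicalSpace X]

lemma InV.mono {V W : Set X} (h : V ⊆ W) {a b : X}
    {e : FundamentalGroupoid.mk a ⟶ FundamentalGroupoid.mk b} (he : InV V e) : InV W e := by
  obtain ⟨p, hp, rfl⟩ := he
  exact ⟨p, fun t => h (hp t), rfl⟩

lemma InV.comp {V : Set X} {a b c : X}
    {e : FundamentalGroupoid.mk a ⟶ FundamentalGroupoid.mk b}
    {e' : FundamentalGroupoid.mk b ⟶ FundamentalGroupoid.mk c}
    (he : InV V e) (he' : InV V e') : InV V (e ≫ e') := by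
  obtain ⟨p, hp, rfl⟩ := he
  obtain ⟨q, hq, rfl⟩ := he'
  refine ⟨p.trans q, fun t => ?_, (Path.Homotopic.Quotient.mk_trans p q).symm⟩
  rw [Path.trans_apply]
  split_ifs
  · exact hp _
  · exact hq _

lemma InV.id {V : Set X} {a : X} (ha : a ∈ V) : InV V (𝟙 (FundamentalGroupoid.mk a)) :=
  ⟨Path.refl a, fun _ => ha, rfl⟩

lemma InV.uniq {V : Set X} (hV : PCon V) {a b : X}
    {e e' : FundamentalGroupoid.mk a ⟶ FundamentalGroupoid.mk b}
    (he : InV V e) (he' : InV V e') : e = e' := by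
  obtain ⟨p, hp, rfl⟩ := he
  obtain ⟨q, hq, rfl⟩ := he'
  exact Path.Homotopic.Quotient.eq.2 (hV.2 _ _ p q hp hq)

lemma InV.ex {V : Set X} {a b : X} (h : JoinedIn V a b) :
    ∃ e : FundamentalGroupoid.mk a ⟶ FundamentalGroupoid.mk b, InV V e :=
  ⟨Path.Homotopic.Quotient.mk h.somePath, h.somePath, h.somePath_mem, rfl⟩

/-- Induction along a path, subordinate to an open cover. -/
lemma path_ind {ι : Type*} (V : ι → Set X) (hV : ∀ i, IsOpen (V i)) (hc : ∀ x, ∃ i, x ∈ V i)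
    (a : X) (M : ∀ b, (FundamentalGroupoid.mk a ⟶ FundamentalGroupoid.mk b) → Prop)
    (h0 : M a (𝟙 _))
    (hs : ∀ b c (e : FundamentalGroupoid.mk a ⟶ FundamentalGroupoid.mk b)
      (d : FundamentalGroupoid.mk b ⟶ FundamentalGroupoid.mk c) (i : ι), InV (V i) d →
      M b e → M c (e ≫ d)) (b : X) (e : FundamentalGroupoid.mk a ⟶ FundamentalGroupoid.mk b) :
    M b e := by
  obtain ⟨p, rfl⟩ := Path.Homotopic.Quotient.mk_surjective e
  obtain ⟨t, t0, tm, ⟨n, hn⟩, ht⟩ := exists_monotone_Icc_subset_open_cover_unitInterval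
    (c := fun i => p ⁻¹' (V i)) (fun i => (hV i).preimage p.continuous)
    (fun x _ => by simpa using hc (p x))
  have key : ∀ m, ∀ (h : p (t 0) = a), M (p (t m))
      (Path.Homotopic.Quotient.mk ((p.subpath (t 0) (t m)).cast h.symm rfl)) := by
    intro m h
    induction m with
    | zero =>
      have : ∀ (c : X) (hc : c = a),
          M c (Path.Homotopic.Quotient.mk ((Path.refl c).cast hc.symm rfl)) := by
        rintro c rfl; exact h0
      have h2 := this _ h
      rwa [← Path.subpath_self] at h2
    | succ m ih =>
      obtain ⟨i, hi⟩ := ht m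
      have := hs _ _ _ (Path.Homotopic.Quotient.mk (p.subpath (t m) (t (m+1)))) i
        ⟨_, fun s => by
          have : p.subpath (t m) (t (m+1)) s ∈ Set.range (p.subpath (t m) (t (m+1))) := ⟨s, rfl⟩
          rw [Path.range_subpath_of_le _ _ _ (tm (Nat.le_succ m))] at this
          obtain ⟨s', hs', hh⟩ := this
          rw [← hh]; exact hi hs', rfl⟩ ih
      convert this using 1
      refine Eq.trans ?_ (Path.Homotopic.Quotient.mk_trans _ _)
      apply Path.Homotopic.Quotient.eq.2
      have h3 := (Path.Homotopy.subpathTransSubpath p (t 0) (t m) (t (m+1))).pathCast h.symm rfl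
      exact ⟨h3.symm⟩
  have h1 : t n = 1 := hn n le_rfl
  have := key n (by rw [t0]; simp)
  have gen : ∀ (s0 s1 : unitInterval) (e0 : s0 = 0) (e1 : s1 = 1) (h : a = p s0),
     M (p s1) (Path.Homotopic.Quotient.mk ((p.subpath s0 s1).cast h rfl)) → 
      M b (Path.Homotopic.Quotient.mk p) := by
    rintro _ _ rfl rfl h hM
    have gen2 : ∀ (c : X) (hc : c = b), M c (Path.Homotopic.Quotient.mk (p.cast rfl hc)) →
      M b (Path.Homotopic.Quotient.mk p) := by
      rintro _ rfl h; exact h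
    apply gen2 _ p.target
    rw [Path.subpath_zero_one] at hM
    exact hM
  exact gen _ _ t0 h1 _ this

/-- Generation half of van Kampen. -/
lemma vk_gen {ι : Type*} (V : Bool → Set X) (hV : ∀ i, IsOpen (V i)) (hc : ∀ x, ∃ i, x ∈ V i)
    (hP : ∀ i, PCon (V i)) (Q : Option ι → Set X) (hQ : ∀ o, ∀ a ∈ Q o, ∀ b ∈ Q o, JoinedIn (Q o) a b)
    (hQV : ∀ x, (∀ i, x ∈ V i) ↔ ∃ o, x ∈ Q o)
    (q : Option ι → X) (hq : ∀ o, q o ∈ Q o)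
    (α : ∀ (i : Bool) (o : Option ι),
      FundamentalGroupoid.mk (q none) ⟶ FundamentalGroupoid.mk (q o))
    (hα : ∀ i o, InV (V i) (α i o)) :
    (Subgroup.closure (Set.range fun j : ι =>
      α true (some j) ≫ inv (α false (some j))) : Subgroup (FundamentalGroup X (q none))) = ⊤ := by
  set H : Subgroup (FundamentalGroup X (q none)) := Subgroup.closure (Set.range fun j : ι =>
      α true (some j) ≫ inv (α false (some j))) with hH
  have hQs : ∀ o i, Q o ⊆ V i := fun o i x hx => (hQV x).2 ⟨o, hx⟩ i
  have hmul : ∀ e e' : FundamentalGroupoid.mk (q none) ⟶ FundamentalGroupoid.mk (q none),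
      (e : FundamentalGroup X (q none)) ∈ H → (e' : FundamentalGroup X (q none)) ∈ H →
      ((e ≫ e' : FundamentalGroupoid.mk (q none) ⟶ FundamentalGroupoid.mk (q none)) :
        FundamentalGroup X (q none)) ∈ H := by
    intro e e' he he'
    have gen : ∀ a b : FundamentalGroup X (q none), a ∈ H → b ∈ H → a * b ∈ H :=
      by
      intro a b ha hb; have := H.mul_mem ha hb; exact this
    exact gen e' e he' he
  have hαα : ∀ i k o, ((α i o ≫ inv (α k o) : FundamentalGroupoid.mk (q none) ⟶ _) :
      FundamentalGroup X (q none)) ∈ H := by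
    intro i k o
    by_cases hik : i = k
    · subst hik; rw [IsIso.hom_inv_id]; exact H.one_mem
    cases o with
    | none =>
      have h1 : ∀ i, α i none = 𝟙 _ := fun i => InV.uniq (hP i) (hα i none)
        (InV.id (hQs none i (hq none)))
      rw [h1, h1]; simpa using! H.one_mem
    | some j =>
      have hj : ((α true (some j) ≫ inv (α false (some j)) : FundamentalGroupoid.mk (q none) ⟶ _) :
        FundamentalGroup X (q none)) ∈ H := Subgroup.subset_closure ⟨j, rfl⟩
      cases i <;> cases k
      · simp at hik
      · have h2 := H.inv_mem hj
        have h3 : (α true (some j) ≫ inv (α false (some j)) : FundamentalGroupoid.mk (q none) ⟶ _)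
          ≫ (α false (some j) ≫ inv (α true (some j))) = 𝟙 _ := by simp
        have h4 : @HMul.hMul (FundamentalGroup X (q none)) (FundamentalGroup X (q none)) _ _
          (α false (some j) ≫ inv (α true (some j)))
          (α true (some j) ≫ inv (α false (some j))) = 1 := h3
        rw [eq_inv_of_mul_eq_one_left h4]; exact h2
      · exact hj
      · simp at hik
  have main : ∀ b (e : FundamentalGroupoid.mk (q none) ⟶ FundamentalGroupoid.mk b),
      ∀ i, b ∈ V i → ∀ δ : FundamentalGroupoid.mk (q none) ⟶ FundamentalGroupoid.mk b,
      InV (V i) δ → ((e ≫ inv δ : FundamentalGroupoid.mk (q none) ⟶ _) :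
        FundamentalGroup X (q none)) ∈ H := by
    intro b e
    refine path_ind V hV hc (q none) (fun b e => ∀ i, b ∈ V i → 
      ∀ δ : FundamentalGroupoid.mk (q none) ⟶ FundamentalGroupoid.mk b,
      InV (V i) δ → ((e ≫ inv δ : FundamentalGroupoid.mk (q none) ⟶ _) :
        FundamentalGroup X (q none)) ∈ H) ?_ ?_ b e
    · intro i hi δ hδ
      rw [InV.uniq (hP i) hδ (InV.id hi)]
      simpa using! H.one_mem
    · intro b c e d i hd ih k hk δ hδ
      have hb : b ∈ V i := by
        obtain ⟨p, hp, _⟩ := hd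
        simpa using hp 0
      have hci : c ∈ V i := by
        obtain ⟨p, hp, _⟩ := hd
        simpa using hp 1
      have hi0 : q none ∈ V i := hQs none i (hq none)
      obtain ⟨δb, hδb⟩ := InV.ex ((hP i).1 _ hi0 b hb)
      have h1 := ih i hb δb hδb
      have h2 : (e ≫ d) ≫ inv δ = (e ≫ inv δb) ≫ ((δb ≫ d) ≫ inv δ) := by simp
      rw [h2]
      refine hmul _ _ h1 ?_
      have h3 : InV (V i) (δb ≫ d) := hδb.comp hd
      by_cases hik : i = k
      · subst hik
        rw [InV.uniq (hP i) h3 hδ, IsIso.hom_inv_id]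
        exact H.one_mem
      · have : ∀ l, c ∈ V l := by
          intro l; cases i <;> cases k <;> cases l <;> simp_all
        obtain ⟨o, ho⟩ := (hQV c).1 this
        obtain ⟨η, hη⟩ := InV.ex (hQ o _ (hq o) c ho)
        have e1 := InV.uniq (hP i) h3 ((hα i o).comp (hη.mono (hQs o i)))
        have e2 := InV.uniq (hP k) hδ ((hα k o).comp (hη.mono (hQs o k)))
        rw [e1, e2]
        have := hαα i k o
        simpa using this
  rw [eq_top_iff]
  intro e _
  have := main (q none) e true (hQs none true (hq none)) (𝟙 _) (InV.id (hQs none true (hq none)))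
  simpa using! this
end vk

section vk2
open CategoryTheory
variable {X : Type*} [TopologicalSpace X]

/-- The bundle core of the principal covering with cocycle `c`. -/
def coverCore {G : Type*} [Group G] [TopologicalSpace G] [DiscreteTopology G] (V : Bool → Set X)
    (hV : ∀ i, IsOpen (V i)) (hc : ∀ x, ∃ i, x ∈ V i) (c : Bool → X → G)
    (hcc : ∀ x, (∀ i, x ∈ V i) → ∀ i, ∀ᶠ y in nhds x, c i y = c i x) :
    FiberBundleCore Bool X G where
  baseSet := V
  isOpen_baseSet := hV
  indexAt x := (hc x).choose
  mem_baseSet_at x := (hc x).choose_spec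
  coordChange i j x g := c j x * (c i x)⁻¹ * g
  coordChange_self i x _ v := by simp
  coordChange_comp i j k x _ v := by simp [mul_assoc]
  continuousOn_coordChange i j := by
    rintro ⟨x, g⟩ ⟨⟨h1, h2⟩, -⟩
    by_cases hij : i = j
    · subst hij
      simpa using continuousWithinAt_snd
    have hall : ∀ l, x ∈ V l := by
      intro l; cases i <;> cases j <;> cases l <;> simp_all
    apply ContinuousAt.continuousWithinAt
    have e : (fun p : X × G => c j p.1 * (c i p.1)⁻¹ * p.2) =ᶠ[nhds (x, g)]
        fun p => c j x * (c i x)⁻¹ * p.2 := by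
      have h3 := (continuous_fst (X := X) (Y := G)).tendsto (x, g)
      filter_upwards [h3.eventually (hcc x hall i), h3.eventually (hcc x hall j)] with p hp hp'
      rw [hp, hp']
    refine ContinuousAt.congr ?_ e.symm
    exact (continuous_of_discreteTopology (f := fun g' : G => c j x * (c i x)⁻¹ * g')).continuousAt.comp
      continuous_snd.continuousAt

/-- Injectivity half of van Kampen. -/
lemma vk_inj {ι : Type*} (V : Bool → Set X) (hV : ∀ i, IsOpen (V i)) (hc : ∀ x, ∃ i, x ∈ V i)
    (Q : Option ι → Set X) (hQo : ∀ o, IsOpen (Q o))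
    (hQd : ∀ o o' x, x ∈ Q o → x ∈ Q o' → o = o')
    (hQV : ∀ x, (∀ i, x ∈ V i) ↔ ∃ o, x ∈ Q o)
    (q : Option ι → X) (hq : ∀ o, q o ∈ Q o)
    (α : ∀ (_ : Bool) (o : Option ι),
      FundamentalGroupoid.mk (q none) ⟶ FundamentalGroupoid.mk (q o))
    (hα : ∀ i o, InV (V i) (α i o)) (β : ι → FundamentalGroup X (q none))
    (hβ : ∀ j, β j = α true (some j) ≫ inv (α false (some j))) :
    Function.Injective (FreeGroup.lift β) := by
  classical
  let _ : TopologicalSpace (FreeGroup ι) := ⊥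
  have : DiscreteTopology (FreeGroup ι) := ⟨rfl⟩
  let n : X → FreeGroup ι := fun x => if h : ∃ j, x ∈ Q (some j) then FreeGroup.of h.choose else 1
  have hn1 : ∀ j x, x ∈ Q (some j) → n x = FreeGroup.of j := by
    intro j x hx
    have h : ∃ j, x ∈ Q (some j) := ⟨j, hx⟩
    have : h.choose = j := by
      have := hQd _ _ x h.choose_spec hx
      simpa using this
    simp only [n, dif_pos h, this]
  have hn0 : ∀ x, x ∈ Q none → n x = 1 := by
    intro x hx
    have h : ¬ ∃ j, x ∈ Q (some j) := by
      rintro ⟨j, hj⟩; have := hQd _ _ x hj hx; simp at this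
    simp only [n, dif_neg h]
  let c : Bool → X → FreeGroup ι := fun i x => if i then 1 else n x
  have hcc : ∀ x, (∀ i, x ∈ V i) → ∀ i, ∀ᶠ y in nhds x, c i y = c i x := by
    intro x hx i
    obtain ⟨o, ho⟩ := (hQV x).1 hx
    filter_upwards [(hQo o).mem_nhds ho] with y hy
    cases i
    · cases o with
      | none => simp [c, hn0 x ho, hn0 y hy]
      | some j => simp [c, hn1 j x ho, hn1 j y hy]
    · simp [c]
  let Z := coverCore V hV hc c hcc
  have cov : IsCoveringMap Z.proj := FiberBundle.isCoveringMap
  let pt : Bool → ∀ x : X, FreeGroup ι → Z.proj ⁻¹' {x} := fun i x g =>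
    ⟨⟨x, Z.coordChange i (Z.indexAt x) x g⟩, rfl⟩
  have hpt : ∀ i j x g, (pt i x g) = pt j x (c j x * (c i x)⁻¹ * g) := by
    intro i j x g
    simp only [pt, Z, coverCore]
    congr 2
    simp [mul_assoc]
    rfl
  have hmono : ∀ i (a b : X) (e : FundamentalGroupoid.mk a ⟶ FundamentalGroupoid.mk b),
      InV (V i) e → ∀ g, cov.monodromy e (pt i a g) = pt i b g := by
    rintro i a b _ ⟨p, hp, rfl⟩ g
    apply Subtype.ext
    have hcont : Continuous (fun t => (Z.localTriv i).toOpenPartialHomeomorph.symm (p t, g)) := by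
      rw [← continuousOn_univ]
      refine (Z.localTriv i).toOpenPartialHomeomorph.continuousOn_symm.comp
        (Continuous.continuousOn (by fun_prop)) ?_
      intro t _
      exact (Z.mem_localTriv_target i _).2 (hp t)
    have h1 := (cov.eq_liftPath_iff (γ := (p : C(unitInterval, X))) (e := (pt i a g).1)
      (Γ := fun t => (Z.localTriv i).toOpenPartialHomeomorph.symm (p t, g))
      (p.source)).2 ⟨hcont, ?_, ?_⟩
    · have h2 := congrFun h1 1
      refine h2.symm.trans ?_
      simp only [Z.localTriv_symm_apply, p.target]
      rfl
    · ext t; simp [Z.localTriv_symm_apply]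
    · simp only [Z.localTriv_symm_apply, p.source]
      rfl
  let ψ : FreeGroup ι →* FundamentalGroup X (q none) := FreeGroup.lift β
  have hgen : ∀ j g, cov.monodromy (α true (some j) ≫ inv (α false (some j)))
      (pt true (q none) g) = pt true (q none) (FreeGroup.of j * g) := by
    intro j g
    have h1 := cov.monodromy_trans_apply (α true (some j)) (inv (α false (some j)))
      (pt true (q none) g)
    refine h1.trans ?_
    rw [hmono true _ _ _ (hα true (some j)), hpt true false]
    have h2 := hmono false _ _ _ (hα false (some j)) (FreeGroup.of j * g)
    have h3 : c false (q (some j)) * (c true (q (some j)))⁻¹ * g = FreeGroup.of j * g := by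
      simp [c, hn1 j _ (hq (some j))]
    rw [h3, ← h2]
    have h4 := cov.monodromy_trans_apply (α false (some j)) (inv (α false (some j)))
      (pt false (q none) (FreeGroup.of j * g))
    refine h4.symm.trans ?_
    have h5 : Path.Homotopic.Quotient.trans (α false (some j)) (inv (α false (some j))) =
      Path.Homotopic.Quotient.refl _ := IsIso.hom_inv_id (α false (some j))
    rw [h5, cov.monodromy_refl, hpt false true]
    simp [c, hn0 _ (hq none)]
  have hall : ∀ w g, cov.monodromyPerm _ (ψ w) (pt true (q none) g) = pt true (q none) (w * g) := by
    intro w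
    induction w using FreeGroup.induction_on with
    | C1 => intro g; rw [map_one, map_one]; simp
    | of j => intro g; have := hgen j g; rw [← hβ j] at this; simpa [ψ] using this
    | inv_of j ih =>
      intro g
      rw [map_inv, map_inv, Equiv.Perm.inv_eq_iff_eq, ih]
      simp
    | mul x y hx hy =>
      intro g
      rw [map_mul, map_mul, Equiv.Perm.mul_apply, hy, hx, mul_assoc]
  rw [injective_iff_map_eq_one]
  intro w hw
  have h1 := hall w 1
  have h2 : ψ w = 1 := hw
  rw [h2, map_one] at h1
  have h3 : pt true (q none) 1 = pt true (q none) (w * 1) := h1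
  have h4 := congrArg (fun z : Z.proj ⁻¹' {q none} => (Z.localTriv true z.1).2) h3
  have h5 : ∀ g, (Z.localTriv true (pt true (q none) g).1).2 = g := by
    intro g
    change c true (q none) * (c (Z.indexAt (q none)) (q none))⁻¹ *
      (c (Z.indexAt (q none)) (q none) * (c true (q none))⁻¹ * g) = g
    simp [mul_assoc]
  simp only [h5] at h4
  simpa using h4.symm

/-- Van Kampen for two simply connected open sets. -/
theorem vk {ι : Type*} (V : Bool → Set X) (hV : ∀ i, IsOpen (V i)) (hc : ∀ x, ∃ i, x ∈ V i)
    (hP : ∀ i, PCon (V i)) (Q : Option ι → Set X) (hQo : ∀ o, IsOpen (Q o))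
    (hQn : ∀ o, (Q o).Nonempty)
    (hQd : ∀ o o' x, x ∈ Q o → x ∈ Q o' → o = o')
    (hQ : ∀ o, ∀ a ∈ Q o, ∀ b ∈ Q o, JoinedIn (Q o) a b)
    (hQV : ∀ x, (∀ i, x ∈ V i) ↔ ∃ o, x ∈ Q o) (x : X) :
    Nonempty (FundamentalGroup X x ≃* FreeGroup ι) := by
  choose q hq using hQn
  have hqV : ∀ o i, q o ∈ V i := fun o i => (hQV (q o)).2 ⟨o, hq o⟩ i
  choose α hα using fun (i : Bool) (o : Option ι) => InV.ex ((hP i).1 _ (hqV none i) _ (hqV o i))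
  let β : ι → FundamentalGroup X (q none) := fun j => α true (some j) ≫ inv (α false (some j))
  have h1 := vk_inj V hV hc Q hQo hQd hQV q hq α hα β (fun _ => rfl)
  have h2 := vk_gen V hV hc hP Q hQ hQV q hq α hα
  let ψ : FreeGroup ι →* FundamentalGroup X (q none) := FreeGroup.lift β
  have hs : Function.Surjective ψ := by
    rw [← MonoidHom.range_eq_top, FreeGroup.range_lift_eq_closure]
    exact h2
  obtain ⟨i, hi⟩ := hc x
  have hj := (hP i).1 _ hi _ (hqV none i)
  exact ⟨(FundamentalGroup.fundamentalGroupMulEquivOfPath hj.somePath).trans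
    (MulEquiv.ofBijective ψ ⟨h1, hs⟩).symm⟩
end vk2

section push
open Set

/-- `V` has flows pushing every compact set into `V` while preserving `V`. -/
def Pushable {E : Type*} [TopologicalSpace E] (V : Set E) : Prop :=
  ∀ K : Set E, IsCompact K → ∃ (τ : ℝ) (Ψ : ℝ → E → E), 0 ≤ τ ∧
    ContinuousOn (fun z : ℝ × E => Ψ z.1 z.2) (Icc 0 τ ×ˢ K) ∧
    (∀ z ∈ K, Ψ 0 z = z) ∧ (∀ z ∈ K, z ∈ V → ∀ t ∈ Icc 0 τ, Ψ t z ∈ V) ∧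
    ∀ z ∈ K, Ψ τ z ∈ V

/-- The reparametrisation that is constant near the ends. -/
def sg (s : unitInterval) : unitInterval := Set.projIcc 0 1 zero_le_one (2 * (s : ℝ) - 1 / 2)

lemma sg_cont : Continuous sg := by
  unfold sg
  exact continuous_projIcc.comp (by fun_prop)

lemma sg_low {s : unitInterval} (h : (s : ℝ) ≤ 1 / 4) : sg s = 0 :=
  Set.projIcc_of_le_left _ (by linarith)

lemma sg_high {s : unitInterval} (h : 3 / 4 ≤ (s : ℝ)) : sg s = 1 :=
  Set.projIcc_of_right_le _ (by linarith)

/-- A bump which vanishes on the boundary of the square. -/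
def bd (s t : unitInterval) : ℝ :=
  min 1 (4 * min (min (s : ℝ) (1 - s)) (min (t : ℝ) (1 - t)))

lemma push {E : Type*} [NormedAddCommGroup E] [NormedSpace ℝ E] (U V : Set E) (hVU : V ⊆ U)
    (hV : Pushable V) (a b : U) (p q : Path a b) (hp : ∀ t, (p t : E) ∈ V)
    (hq : ∀ t, (q t : E) ∈ V) : p.Homotopic q := by
  let H : unitInterval × unitInterval → E := fun z =>
    (1 - (z.1 : ℝ)) • (p z.2 : E) + (z.1 : ℝ) • (q z.2 : E)
  have hH : Continuous H := by fun_prop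
  obtain ⟨τ, Ψ, hτ, hc, h0, h1, h2⟩ := hV (range H) (isCompact_range hH)
  have b0 : ∀ s t, 0 ≤ bd s t := by
    intro s t
    refine le_min zero_le_one (mul_nonneg (by norm_num) ?_)
    exact le_min (le_min s.2.1 (by linarith [s.2.2])) (le_min t.2.1 (by linarith [t.2.2]))
  have b1 : ∀ s t, bd s t ≤ 1 := fun s t => min_le_left _ _
  let M : unitInterval × unitInterval → E := fun z => Ψ (τ * bd z.1 z.2) (H (sg z.1, sg z.2))
  have hbd : Continuous fun z : unitInterval × unitInterval => bd z.1 z.2 := by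
    unfold bd; fun_prop
  have hM : Continuous M := by
    rw [← continuousOn_univ]
    refine hc.comp (f := fun z : unitInterval × unitInterval =>
      (τ * bd z.1 z.2, H (sg z.1, sg z.2))) ?_ ?_
    · apply Continuous.continuousOn
      have := sg_cont
      fun_prop
    · intro z _
      refine ⟨⟨mul_nonneg hτ (b0 _ _), ?_⟩, mem_range_self _⟩
      exact mul_le_of_le_one_right hτ (b1 _ _)
  have hMV : ∀ z, M z ∈ V := by
    rintro ⟨s, t⟩
    by_cases h : bd s t = 1
    · simp only [M, h, mul_one]
      exact h2 _ (mem_range_self _)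
    · apply h1 _ (mem_range_self _)
      · have hlt : bd s t < 1 := lt_of_le_of_ne (b1 _ _) h
        simp only [bd, min_lt_iff, lt_irrefl, false_or] at hlt
        have : min (min (s : ℝ) (1 - s)) (min (t : ℝ) (1 - t)) < 1 / 4 := by linarith
        simp only [min_lt_iff] at this
        rcases this with (h | h) | (h | h)
        · simpa [H, sg_low h.le] using hp _
        · simpa [H, sg_high (by linarith : 3 / 4 ≤ (s : ℝ))] using hq _
        · simp only [H, sg_low h.le, p.source, q.source, ← add_smul]
          simpa using hp 0
        · simp only [H, sg_high (by linarith : 3 / 4 ≤ (t : ℝ)), p.target, q.target, ← add_smul]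
          simpa using hp 1
      · exact ⟨mul_nonneg hτ (b0 _ _), mul_le_of_le_one_right hτ (b1 _ _)⟩
  have sg0 : sg 0 = 0 := sg_low (by norm_num)
  have sg1 : sg 1 = 1 := sg_high (by norm_num)
  have hM0 : ∀ s t, bd s t = 0 → M (s, t) = H (sg s, sg t) := by
    intro s t h
    simp only [M, h, mul_zero]
    exact h0 _ (mem_range_self _)
  have F : (p.reparam sg sg_cont sg0 sg1).Homotopy (q.reparam sg sg_cont sg0 sg1) :=
    { toFun := fun z => ⟨M z, hVU (hMV z)⟩
      continuous_toFun := hM.subtype_mk _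
      map_zero_left := by
        intro t
        apply Subtype.ext
        change M (0, t) = p (sg t)
        rw [hM0 _ _ (by
          have : min (t : ℝ) (1 - t) ≥ 0 := le_min t.2.1 (by linarith [t.2.2])
          simp [bd, this])]
        simp [H, sg0]
      map_one_left := by
        intro t
        apply Subtype.ext
        change M (1, t) = q (sg t)
        rw [hM0 _ _ (by
          have : min (t : ℝ) (1 - t) ≥ 0 := le_min t.2.1 (by linarith [t.2.2])
          simp [bd, this])]
        simp [H, sg1]
      prop' := by
        intro s t ht
        apply Subtype.ext
        change M (s, t) = p (sg t)
        have hs : min (s : ℝ) (1 - s) ≥ 0 := le_min s.2.1 (by linarith [s.2.2])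
        rcases ht with rfl | rfl
        · rw [hM0 _ _ (by simp [bd, hs])]
          simp [H, sg0, ← add_smul]
        · rw [hM0 _ _ (by simp [bd, hs])]
          simp [H, sg1, ← add_smul] }
  have e1 : p.Homotopic (p.reparam sg sg_cont sg0 sg1) := ⟨Path.Homotopy.reparam _ _ _ _ _⟩
  have e2 : q.Homotopic (q.reparam sg sg_cont sg0 sg1) := ⟨Path.Homotopy.reparam _ _ _ _ _⟩
  exact (e1.trans ⟨F⟩).trans e2.symm

lemma Pushable.homeo {E F : Type*} [TopologicalSpace E] [TopologicalSpace F] (L : E ≃ₜ F)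
    (V : Set F) (hV : Pushable V) : Pushable (L ⁻¹' V) := by
  intro K hK
  obtain ⟨τ, Ψ, hτ, hc, h0, h1, h2⟩ := hV (L '' K) (hK.image L.continuous)
  refine ⟨τ, fun t z => L.symm (Ψ t (L z)), hτ, ?_, ?_, ?_, ?_⟩
  · refine L.symm.continuous.comp_continuousOn (hc.comp (f := fun z : ℝ × E => (z.1, L z.2))
      (Continuous.continuousOn (by fun_prop)) ?_)
    rintro ⟨t, z⟩ ⟨ht, hz⟩
    exact ⟨ht, mem_image_of_mem _ hz⟩
  · intro z hz
    simp [h0 _ (mem_image_of_mem L hz)]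
  · intro z hz hzV t ht
    simpa using h1 _ (mem_image_of_mem L hz) hzV t ht
  · intro z hz
    simpa using h2 _ (mem_image_of_mem L hz)
end push

section flow
open Set Metric

/-- Global flow on `[0, τ]` of a compactly supported `C¹` vector field. -/
lemma flow_exists {E : Type*} [NormedAddCommGroup E] [NormedSpace ℝ E] [CompleteSpace E]
    (W : E → E) (hW : ContDiff ℝ 1 W) (hs : HasCompactSupport W) (τ : ℝ) (hτ : 0 ≤ τ) (r : ℝ)
    (hr : 0 ≤ r) :
    ∃ Ψ : ℝ → E → E, ContinuousOn (fun z : ℝ × E => Ψ z.1 z.2) (Icc 0 τ ×ˢ closedBall 0 r) ∧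
      (∀ z ∈ closedBall (0 : E) r, Ψ 0 z = z) ∧
      ∀ z ∈ closedBall (0 : E) r, ∀ t ∈ Icc 0 τ,
        HasDerivWithinAt (fun t => Ψ t z) (W (Ψ t z)) (Icc 0 τ) t := by
  obtain ⟨C, hC⟩ := hW.lipschitzWith_of_hasCompactSupport hs (by simp)
  obtain ⟨L, hL⟩ := hs.exists_bound_of_continuous hW.continuous
  have hL0 : 0 ≤ L := (norm_nonneg _).trans (hL 0)
  have PL : IsPicardLindelof (fun _ => W) (⟨0, ⟨le_rfl, hτ⟩⟩ : Icc 0 τ) (0 : E)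
      (⟨r + L * τ, by positivity⟩ : NNReal) ⟨r, hr⟩ ⟨L, hL0⟩ C := by
    refine IsPicardLindelof.of_time_independent (fun x _ => hL x) hC.lipschitzOnWith ?_
    change L * max (τ - 0) (0 - 0) ≤ (r + L * τ) - r
    rw [sub_zero, sub_zero, max_eq_left hτ]
    linarith
  obtain ⟨α, h1, h2⟩ := PL.exists_forall_mem_closedBall_eq_hasDerivWithinAt_continuousOn
  refine ⟨fun t z => α (z, t), ?_, fun z hz => (h1 z hz).1, fun z hz => (h1 z hz).2⟩
  refine h2.comp (f := fun z : ℝ × E => (z.2, z.1)) (by fun_prop) ?_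
  rintro ⟨t, z⟩ ⟨ht, hz⟩
  exact ⟨hz, ht⟩

/-- The analytic input on the polynomial. -/
structure Tame (g gx gy : ℂ × ℂ → ℂ) (O : Set ℂ) : Prop where
  hg : ContDiff ℝ 1 g
  hx : ContDiff ℝ 1 gx
  hy : ContDiff ℝ 1 gy
  hd : ∀ p, HasFDerivAt g (gx p • ContinuousLinearMap.fst ℂ ℂ ℂ +
    gy p • ContinuousLinearMap.snd ℂ ℂ ℂ) p
  crit : ∀ p, g p ∈ O → gx p ≠ 0 ∨ gy p ≠ 0
  esc : ∀ D : Set ℂ, IsCompact D → D ⊆ O → ∃ R : ℝ, ∀ p, g p ∈ D → R < ‖p.1‖ → gy p ≠ 0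
  prop : ∀ D : Set ℂ, IsCompact D → ∀ X : ℝ, ∃ Y : ℝ, ∀ p, g p ∈ D → ‖p.1‖ ≤ X → ‖p.2‖ ≤ Y

lemma smooth_cut (O J : Set ℂ) (hO : IsOpen O) (hJ : IsCompact J) (hJO : J ⊆ O) :
    ∃ (β : ℂ → ℝ) (D : Set ℂ), ContDiff ℝ 1 β ∧ IsCompact D ∧ D ⊆ O ∧ (∀ w, 0 ≤ β w) ∧
      (∀ w, β w ≤ 1) ∧ (∀ w ∈ J, β w = 1) ∧ ∀ w, w ∉ D → β w = 0 := by
  obtain ⟨D, hD, h1, h2⟩ := exists_compact_between hJ hO hJO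
  obtain ⟨β, b1, b2, b3, b4⟩ := exists_contMDiff_support_eq_eq_one_iff
    (I := modelWithCornersSelf ℝ ℂ) (n := 1) (isOpen_interior (s := D)) hJ.isClosed h1
  refine ⟨β, D, b1.contDiff, hD, h2, fun w => (b2 ⟨w, rfl⟩).1, fun w => (b2 ⟨w, rfl⟩).2,
    fun w hw => (b4 w).1 hw, fun w hw => ?_⟩
  by_contra h
  have : w ∈ Function.support β := h
  rw [b3] at this
  exact hw (interior_subset this)

lemma cdiv {f g : ℂ × ℂ → ℂ} {p : ℂ × ℂ} (hf : ContDiffAt ℝ 1 f p) (hg : ContDiffAt ℝ 1 g p)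
    (h : g p ≠ 0) : ContDiffAt ℝ 1 (fun p => f p / g p) p := by
  simp only [div_eq_mul_inv]
  exact hf.mul (hg.inv h)

/-- The vector field lifting `∂/∂(Re g)`. -/
lemma Tame.field {g gx gy : ℂ × ℂ → ℂ} {O : Set ℂ} (T : Tame g gx gy O)
    (β : ℂ → ℝ) (D : Set ℂ) (hβ : ContDiff ℝ 1 β) (hD : IsCompact D) (hDO : D ⊆ O)
    (hβ0 : ∀ w, w ∉ D → β w = 0) :
    ∃ F : ℂ × ℂ → ℂ × ℂ, ContDiff ℝ 1 F ∧ (∀ p, g p ∉ D → F p = 0) ∧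
      (∀ p, gx p * (F p).1 + gy p * (F p).2 = β (g p)) ∧
      ∃ M, ∀ p, ‖(F p).1‖ ≤ M := by
  obtain ⟨R', hR'⟩ := T.esc D hD hDO
  obtain ⟨R, hR0, hR⟩ : ∃ R : ℝ, 0 < R ∧ ∀ p, g p ∈ D → R ≤ ‖p.1‖ → gy p ≠ 0 :=
    ⟨max 0 R' + 1, by positivity, fun p hp h => hR' p hp (by
      have := le_max_right 0 R'; linarith)⟩
  let χ : ContDiffBump (0 : ℂ) := ⟨R + 1, R + 2, by linarith, by linarith⟩
  have hχ : ContDiff ℝ 1 (χ : ℂ → ℝ) := χ.contDiff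
  let N : ℂ × ℂ → ℂ := fun p => gx p * (starRingEnd ℂ) (gx p) + gy p * (starRingEnd ℂ) (gy p)
  have hN : ∀ p, g p ∈ O → N p ≠ 0 := by
    intro p hp h
    simp only [N, Complex.mul_conj, ← Complex.ofReal_add, Complex.ofReal_eq_zero] at h
    have a1 := Complex.normSq_nonneg (gx p)
    have a2 := Complex.normSq_nonneg (gy p)
    rcases T.crit p hp with h' | h'
    · exact h' (Complex.normSq_eq_zero.1 (by linarith))
    · exact h' (Complex.normSq_eq_zero.1 (by linarith))
  have cconj : ContDiff ℝ 1 (starRingEnd ℂ : ℂ → ℂ) := Complex.conjCLE.contDiff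
  have cof : ContDiff ℝ 1 ((↑) : ℝ → ℂ) := Complex.ofRealCLM.contDiff
  have hNs : ContDiff ℝ 1 N := (T.hx.mul (cconj.comp T.hx)).add (T.hy.mul (cconj.comp T.hy))
  have hB : ContDiff ℝ 1 (fun p => (β (g p) : ℂ)) := cof.comp (hβ.comp T.hg)
  have hX : ContDiff ℝ 1 (fun p : ℂ × ℂ => (χ p.1 : ℂ)) := cof.comp (hχ.comp contDiff_fst)
  let F1 : ℂ × ℂ → ℂ := fun p => β (g p) * (χ p.1 * ((starRingEnd ℂ) (gx p) / N p))
  let F2 : ℂ × ℂ → ℂ := fun p => β (g p) * (χ p.1 * ((starRingEnd ℂ) (gy p) / N p) +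
    (1 - χ p.1) / gy p)
  have hout : ∀ p, g p ∉ D → ∀ᶠ p' in nhds p, (β (g p') : ℂ) = 0 := by
    intro p hp
    have := T.hg.continuous.tendsto p |>.eventually (hD.isClosed.isOpen_compl.mem_nhds hp)
    filter_upwards [this] with p' hp'
    rw [hβ0 _ hp', Complex.ofReal_zero]
  have hF1 : ContDiff ℝ 1 F1 := by
    rw [contDiff_iff_contDiffAt]
    intro p
    by_cases hp : g p ∈ D
    · exact hB.contDiffAt.mul (hX.contDiffAt.mul
        (cdiv (cconj.comp T.hx).contDiffAt hNs.contDiffAt (hN p (hDO hp))))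
    · refine contDiffAt_const (c := (0 : ℂ)) |>.congr_of_eventuallyEq ?_
      filter_upwards [hout p hp] with p' hp'
      simp [F1, hp']
  have hF2 : ContDiff ℝ 1 F2 := by
    rw [contDiff_iff_contDiffAt]
    intro p
    by_cases hp : g p ∈ D
    · refine hB.contDiffAt.mul ((hX.contDiffAt.mul
        (cdiv (cconj.comp T.hy).contDiffAt hNs.contDiffAt (hN p (hDO hp)))).add ?_)
      by_cases hp2 : R ≤ ‖p.1‖
      · exact cdiv (contDiffAt_const.sub hX.contDiffAt) T.hy.contDiffAt (hR p hp hp2)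
      · refine contDiffAt_const (c := (0 : ℂ)) |>.congr_of_eventuallyEq ?_
        have : ∀ᶠ p' : ℂ × ℂ in nhds p, ‖p'.1‖ < R :=
          (continuous_fst.norm.tendsto p).eventually (gt_mem_nhds (not_le.1 hp2))
        filter_upwards [this] with p' hp'
        have : χ p'.1 = 1 := χ.one_of_mem_closedBall (by
          simp only [mem_closedBall, dist_zero_right, χ]; linarith)
        simp [this]
    · refine contDiffAt_const (c := (0 : ℂ)) |>.congr_of_eventuallyEq ?_
      filter_upwards [hout p hp] with p' hp'
      simp [F2, hp']
  have hcs : HasCompactSupport F1 := by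
    obtain ⟨Y, hY⟩ := T.prop D hD (R + 2)
    refine HasCompactSupport.of_support_subset_isCompact
      ((isCompact_closedBall (0 : ℂ) (R + 2)).prod (isCompact_closedBall (0 : ℂ) Y)) ?_
    intro p hp
    have h1 : g p ∈ D := by
      by_contra h
      exact hp (by simp [F1, hβ0 _ h])
    have h2 : ‖p.1‖ ≤ R + 2 := by
      by_contra h
      have : χ p.1 = 0 := χ.zero_of_le_dist (by
        simp only [dist_zero_right, χ]; linarith)
      exact hp (by simp [F1, this])
    simpa using ⟨h2, hY p h1 h2⟩
  obtain ⟨M, hM⟩ := hcs.exists_bound_of_continuous hF1.continuous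
  refine ⟨fun p => (F1 p, F2 p), hF1.prodMk hF2, ?_, ?_, M, hM⟩
  · intro p hp
    simp [F1, F2, hβ0 _ hp]
  · intro p
    by_cases hp : g p ∈ D
    · have hNp := hN p (hDO hp)
      have e1 : gx p * ((starRingEnd ℂ) (gx p) / N p) + gy p * ((starRingEnd ℂ) (gy p) / N p) = 1 := by
        rw [← mul_div_assoc, ← mul_div_assoc, ← add_div]
        exact div_self hNp
      have e2 : gy p * ((1 - χ p.1) / gy p) = 1 - χ p.1 := by
        by_cases hy : gy p = 0
        · have : ‖p.1‖ < R := by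
            by_contra h
            exact hR p hp (not_lt.1 h) hy
          have : χ p.1 = 1 := χ.one_of_mem_closedBall (by
            simp only [mem_closedBall, dist_zero_right, χ]; linarith)
          simp [this]
        · field_simp
      simp only [F1, F2]
      linear_combination (β (g p) : ℂ) * χ p.1 * e1 + β (g p) * e2
    · simp [F1, F2, hβ0 _ hp]

/-- The plane minus horizontal rays to the right. -/
def Slit {r : ℕ} (c : Fin r → ℂ) : Set ℂ := {w | ∀ i, ¬ (w.im = (c i).im ∧ (c i).re ≤ w.re)}

theorem Tame.pushable {g gx gy : ℂ × ℂ → ℂ} {O : Set ℂ} (T : Tame g gx gy O) (hO : IsOpen O)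
    {r : ℕ} (c : Fin r → ℂ) (hc : ∀ i w, w.im = (c i).im → (c i).re ≤ w.re → w ∈ O) :
    Pushable (g ⁻¹' Slit c) := by
  intro K hK
  obtain ⟨B, hB⟩ : ∃ B, ∀ p ∈ K, (g p).re ≤ B := by
    have := hK.bddAbove_image (f := fun p => (g p).re)
      (Complex.continuous_re.comp T.hg.continuous).continuousOn
    obtain ⟨B, hB⟩ := this
    exact ⟨B, fun p hp => hB ⟨p, hp, rfl⟩⟩
  obtain ⟨τ, hτ0, hτ⟩ : ∃ τ : ℝ, 0 ≤ τ ∧ ∀ i, B - τ < (c i).re := by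
    obtain ⟨m, hm⟩ := (Set.finite_range fun i => B - (c i).re).bddAbove
    refine ⟨max 0 m + 1, by positivity, fun i => ?_⟩
    have h1 := hm ⟨i, rfl⟩
    have h2 := le_max_right 0 m
    linarith
  let J : Set ℂ := ⋃ i, (fun s : ℝ => (⟨s, (c i).im⟩ : ℂ)) '' Icc (c i).re B
  have hJ : IsCompact J := by
    refine isCompact_iUnion fun i => isCompact_Icc.image ?_
    have : (fun s : ℝ => (⟨s, (c i).im⟩ : ℂ)) = fun s : ℝ => (s : ℂ) + (c i).im * Complex.I := by
      funext s; apply Complex.ext <;> simp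
    rw [this]; fun_prop
  have hJO : J ⊆ O := by
    intro w hw
    obtain ⟨i, s, hs, rfl⟩ := mem_iUnion.1 hw
    exact hc i _ rfl hs.1
  obtain ⟨β, D, hβ, hD, hDO, b0, b1, bJ, bD⟩ := smooth_cut O J hO hJ hJO
  obtain ⟨F, hF, hFD, hFg, M, hM⟩ := T.field β D hβ hD hDO bD
  have hM0 : 0 ≤ M := (norm_nonneg _).trans (hM 0)
  obtain ⟨r, hr0, hr⟩ : ∃ r : ℝ, 0 < r ∧ K ⊆ closedBall 0 r := by
    obtain ⟨r, hr⟩ := hK.isBounded.subset_closedBall 0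
    exact ⟨max r 0 + 1, by positivity, hr.trans (closedBall_subset_closedBall (by
      have := le_max_left r 0; linarith))⟩
  let χ : ContDiffBump (0 : ℂ) := ⟨r + M * τ, r + M * τ + 1, by positivity, by linarith⟩
  have hχ : ContDiff ℝ 1 (χ : ℂ → ℝ) := χ.contDiff
  let W : ℂ × ℂ → ℂ × ℂ := fun p => (-χ p.1) • F p
  have hW : ContDiff ℝ 1 W := (hχ.comp contDiff_fst).neg.smul hF
  have hWs : HasCompactSupport W := by
    obtain ⟨Y, hY⟩ := T.prop D hD (r + M * τ + 1)
    refine HasCompactSupport.of_support_subset_isCompact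
      ((isCompact_closedBall (0 : ℂ) (r + M * τ + 1)).prod (isCompact_closedBall (0 : ℂ) Y)) ?_
    intro p hp
    have h1 : g p ∈ D := by
      by_contra h
      exact hp (by simp [W, hFD _ h])
    have h2 : ‖p.1‖ ≤ r + M * τ + 1 := by
      by_contra h
      have : χ p.1 = 0 := χ.zero_of_le_dist (by
        simp only [dist_zero_right, χ]; linarith)
      exact hp (by simp [W, this])
    simpa using ⟨h2, hY p h1 h2⟩
  obtain ⟨Ψ, p1, p2, p3⟩ := flow_exists W hW hWs τ hτ0 r hr0.le
  -- derivative of `g` along the flow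
  have hder : ∀ z ∈ K, ∀ t ∈ Icc 0 τ, HasDerivWithinAt (fun t => g (Ψ t z))
      (-((χ (Ψ t z).1 * β (g (Ψ t z)) : ℝ) : ℂ)) (Icc 0 τ) t := by
    intro z hz t ht
    have h1 := p3 z (hr hz) t ht
    have h2 := ((T.hd (Ψ t z)).restrictScalars ℝ).comp_hasDerivWithinAt t h1
    refine h2.congr_deriv ?_
    have := hFg (Ψ t z)
    simp [W]
    linear_combination (-(χ (Ψ t z).1 : ℂ)) * this
  have hre : ∀ z ∈ K, ∀ t ∈ Icc 0 τ, HasDerivWithinAt (fun t => (g (Ψ t z)).re)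
      (-(χ (Ψ t z).1 * β (g (Ψ t z)))) (Icc 0 τ) t := by
    intro z hz t ht
    have := Complex.reCLM.hasFDerivAt.comp_hasDerivWithinAt t (hder z hz t ht)
    refine this.congr_deriv ?_
    simp
  have him : ∀ z ∈ K, ∀ t ∈ Icc 0 τ, (g (Ψ t z)).im = (g z).im := by
    intro z hz t ht
    have h1 : ∀ t ∈ Icc 0 τ, HasDerivWithinAt (fun t => (g (Ψ t z)).im) 0 (Icc 0 τ) t := by
      intro t ht
      have := Complex.imCLM.hasFDerivAt.comp_hasDerivWithinAt t (hder z hz t ht)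
      refine this.congr_deriv ?_
      simp
    have h2 := norm_image_sub_le_of_norm_deriv_le_segment' (C := 0) h1 (by simp) t ht
    rw [p2 z (hr hz)] at h2
    simp only [zero_mul, norm_le_zero_iff] at h2
    linarith
  have hanti : ∀ z ∈ K, AntitoneOn (fun t => (g (Ψ t z)).re) (Icc 0 τ) := by
    intro z hz
    refine antitoneOn_of_hasDerivWithinAt_nonpos (convex_Icc _ _)
      (fun t ht => (hre z hz t ht).continuousWithinAt)
      (fun t ht => (hre z hz t (interior_subset ht)).mono interior_subset) ?_
    intro t _
    have := mul_nonneg (χ.nonneg (x := (Ψ t z).1)) (b0 (g (Ψ t z)))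
    linarith
  have hx : ∀ z ∈ K, ∀ t ∈ Icc 0 τ, χ (Ψ t z).1 = 1 := by
    intro z hz t ht
    apply χ.one_of_mem_closedBall
    have h1 : ∀ t ∈ Icc 0 τ, HasDerivWithinAt (fun t => (Ψ t z).1) (W (Ψ t z)).1 (Icc 0 τ) t := by
      intro t ht
      exact (ContinuousLinearMap.fst ℝ ℂ ℂ).hasFDerivAt.comp_hasDerivWithinAt t (p3 z (hr hz) t ht)
    have h2 := norm_image_sub_le_of_norm_deriv_le_segment' (C := M) h1 (by
      intro s _
      simp only [W, Prod.smul_fst, norm_smul, norm_neg, Real.norm_eq_abs, abs_of_nonneg χ.nonneg]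
      exact (mul_le_of_le_one_left (norm_nonneg _) χ.le_one).trans (hM _)) t ht
    rw [p2 z (hr hz)] at h2
    have h3 : ‖z.1‖ ≤ r := (norm_fst_le z).trans (by simpa using hr hz)
    have h4 : ‖(Ψ t z).1‖ ≤ ‖(Ψ t z).1 - z.1‖ + ‖z.1‖ := by
      simpa using norm_add_le ((Ψ t z).1 - z.1) z.1
    have h5 : M * (t - 0) ≤ M * τ := mul_le_mul_of_nonneg_left (by linarith [ht.2]) hM0
    simp only [mem_closedBall, dist_zero_right, χ]
    linarith
  refine ⟨τ, Ψ, hτ0, p1.mono (prod_mono le_rfl hr), fun z hz => p2 z (hr hz), ?_, ?_⟩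
  · rintro z hz hzV t ht i ⟨h1, h2⟩
    refine hzV i ⟨?_, ?_⟩
    · rw [← h1, him z hz t ht]
    · have := hanti z hz ⟨le_rfl, hτ0⟩ ht ht.1
      simp only [p2 z (hr hz)] at this
      linarith
  · rintro z hz i ⟨h1, h2⟩
    have hin : ∀ t ∈ Icc 0 τ, β (g (Ψ t z)) = 1 := by
      intro t ht
      apply bJ
      refine mem_iUnion.2 ⟨i, (g (Ψ t z)).re, ⟨?_, ?_⟩, ?_⟩
      · exact h2.trans (hanti z hz ht ⟨hτ0, le_rfl⟩ ht.2)
      · have := hanti z hz ⟨le_rfl, hτ0⟩ ht ht.1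
        simp only [p2 z (hr hz)] at this
        exact this.trans (hB z hz)
      · apply Complex.ext
        · rfl
        · simp only
          rw [him z hz t ht, ← h1, him z hz τ ⟨hτ0, le_rfl⟩]
    have h3 : ∀ t ∈ Icc 0 τ, HasDerivWithinAt (fun t => (g (Ψ t z)).re + t) 0 (Icc 0 τ) t := by
      intro t ht
      refine ((hre z hz t ht).add (hasDerivWithinAt_id t _)).congr_deriv ?_
      rw [hx z hz t ht, hin t ht]; norm_num
    have h4 := norm_image_sub_le_of_norm_deriv_le_segment' (C := 0) h3 (by simp) τ ⟨hτ0, le_rfl⟩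
    rw [p2 z (hr hz)] at h4
    simp only [zero_mul, norm_le_zero_iff] at h4
    have := hB z hz
    have := hτ i
    linarith
end flow

section algebra
open Set Metric
open scoped Polynomial

/-- Uniform bound on roots. -/
lemma root_bound {Z : Type*} [TopologicalSpace Z] (K : Set Z) (hK : IsCompact K) (p : Z → ℂ[X])
    (n : ℕ) (hn : ∀ z ∈ K, (p z).natDegree = n) (hp : ∀ z ∈ K, p z ≠ 0)
    (hc : ∀ i, ContinuousOn (fun z => (p z).coeff i) K) :
    ∃ R : ℝ, ∀ z ∈ K, ∀ w, (p z).eval w = 0 → ‖w‖ ≤ R := by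
  have hlc : ∀ z ∈ K, (p z).coeff n ≠ 0 := by
    intro z hz
    rw [← hn z hz]
    exact Polynomial.leadingCoeff_ne_zero.2 (hp z hz)
  obtain ⟨R, hR⟩ := hK.bddAbove_image
    (f := fun z => (∑ i ∈ Finset.range n, ‖(p z).coeff i‖ / ‖(p z).coeff n‖) + 1) (by
      refine ContinuousOn.add (continuousOn_finsetSum _ fun i _ => ?_) continuousOn_const
      exact (hc i).norm.div (hc n).norm fun z hz => norm_ne_zero_iff.2 (hlc z hz))
  refine ⟨R, fun z hz w hw => ?_⟩
  have h1 := Polynomial.IsRoot.norm_lt_cauchyBound (hp z hz) hw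
  have h2 : (Polynomial.cauchyBound (p z) : ℝ) ≤
      (∑ i ∈ Finset.range n, ‖(p z).coeff i‖ / ‖(p z).coeff n‖) + 1 := by
    rw [Polynomial.cauchyBound, Polynomial.leadingCoeff, hn z hz]
    have h3 : ((Finset.range n).sup (fun x => ‖(p z).coeff x‖₊)) / ‖(p z).coeff n‖₊ ≤
      ∑ i ∈ Finset.range n, ‖(p z).coeff i‖₊ / ‖(p z).coeff n‖₊ := by
      rw [← Finset.sum_div]
      gcongr
      refine Finset.sup_le fun i hi => ?_
      exact Finset.single_le_sum (f := fun i => ‖(p z).coeff i‖₊) (fun _ _ => zero_le) hi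
    have h4 : (((Finset.range n).sup (fun x => ‖(p z).coeff x‖₊)) / ‖(p z).coeff n‖₊ + 1 : NNReal) ≤
      (∑ i ∈ Finset.range n, ‖(p z).coeff i‖₊ / ‖(p z).coeff n‖₊) + 1 := by gcongr
    have h7 := NNReal.coe_le_coe.2 h4
    refine h7.trans (le_of_eq ?_)
    push_cast
    rfl
  have h5 : (∑ i ∈ Finset.range n, ‖(p z).coeff i‖ / ‖(p z).coeff n‖) + 1 ≤ R := hR ⟨z, hz, rfl⟩
  have h6 : ‖w‖ < (Polynomial.cauchyBound (p z) : ℝ) := h1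
  linarith

/-- Coefficientwise derivative. -/
def dX : Derivation ℤ ℂ[X][X] ℂ[X][X] :=
  @Differential.mapCoeffs ℂ[X] _ ⟨Polynomial.derivative'.restrictScalars ℤ⟩

lemma dX_coeff (p : ℂ[X][X]) (i : ℕ) : (dX p).coeff i = Polynomial.derivative (p.coeff i) := rfl

lemma dX_monomial (n : ℕ) (a : ℂ[X]) :
    dX (Polynomial.monomial n a) = Polynomial.monomial n (Polynomial.derivative a) := by
  ext i : 1
  rw [dX_coeff, Polynomial.coeff_monomial, Polynomial.coeff_monomial]
  split_ifs <;> simp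

lemma dX_C (a : ℂ[X]) : dX (Polynomial.C a) = Polynomial.C (Polynomial.derivative a) := by
  simpa using dX_monomial 0 a

lemma dX_aeval (G D : ℂ[X][X]) : dX (Polynomial.aeval G D) =
    Polynomial.aeval G (dX D) + Polynomial.aeval G (Polynomial.derivative D) * dX G := by
  induction D using Polynomial.induction_on' with
  | add p q hp hq => simp only [map_add, hp, hq]; ring
  | monomial n a =>
    rw [dX_monomial, Polynomial.derivative_monomial]
    simp only [Polynomial.aeval_monomial, Derivation.leibniz, Derivation.leibniz_pow,
      Polynomial.algebraMap_eq, dX_C, smul_eq_mul, nsmul_eq_mul, map_mul, map_natCast]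
    ring

lemma eval_hasFDerivAt (G : ℂ[X][X]) (p : ℂ × ℂ) :
    HasFDerivAt (fun p : ℂ × ℂ => G.evalEval p.1 p.2)
      ((dX G).evalEval p.1 p.2 • ContinuousLinearMap.fst ℂ ℂ ℂ +
        (Polynomial.derivative G).evalEval p.1 p.2 • ContinuousLinearMap.snd ℂ ℂ ℂ) p := by
  induction G using Polynomial.induction_on' with
  | add a b ha hb =>
    simp only [map_add, Polynomial.evalEval_add]
    refine (ha.add hb).congr_fderiv ?_
    ext <;> simp
  | monomial n a =>
    rw [dX_monomial, Polynomial.derivative_monomial]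
    have e : ∀ (m : ℕ) (b : ℂ[X]) (x y : ℂ),
        (Polynomial.monomial m b).evalEval x y = b.eval x * y ^ m := by
      intro m b x y
      simp [Polynomial.evalEval]
    simp only [e]
    have h1 := (a.hasDerivAt p.1).comp_hasFDerivAt p (hasFDerivAt_fst (𝕜 := ℂ))
    have h2 := (hasDerivAt_pow n p.2).comp_hasFDerivAt p (hasFDerivAt_snd (𝕜 := ℂ))
    refine (h1.mul h2).congr_fderiv ?_
    ext <;> simp <;> ring

lemma eval_contDiff (G : ℂ[X][X]) : ContDiff ℂ 1 (fun p : ℂ × ℂ => G.evalEval p.1 p.2) := by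
  induction G using Polynomial.induction_on' with
  | add a b ha hb =>
    simp only [Polynomial.evalEval_add]
    exact ha.add hb
  | monomial n a =>
    have e : ∀ (m : ℕ) (b : ℂ[X]) (x y : ℂ),
        (Polynomial.monomial m b).evalEval x y = b.eval x * y ^ m := by
      intro m b x y
      simp [Polynomial.evalEval]
    simp only [e]
    have := (Polynomial.contDiff_aeval (𝕜 := ℂ) a 1).comp (contDiff_fst (𝕜 := ℂ) (E := ℂ) (F := ℂ))
    exact ContDiff.mul (by simpa [Function.comp_def] using this) (contDiff_snd.pow n)
end algebra

section algebra2
open Set Metric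
open scoped Polynomial

/-- `G` has a nonzero constant leading coefficient. -/
def LC (G : ℂ[X][X]) : Prop := ∃ a : ℂ, a ≠ 0 ∧ G.leadingCoeff = Polynomial.C a

lemma LC.monic {G : ℂ[X][X]} (h : LC G) :
    ∃ b : ℂ, b ≠ 0 ∧ (Polynomial.C (Polynomial.C b) * G).Monic := by
  obtain ⟨a, ha, h⟩ := h
  refine ⟨a⁻¹, inv_ne_zero ha, ?_⟩
  apply Polynomial.monic_C_mul_of_mul_leadingCoeff_eq_one
  rw [h, ← Polynomial.C_mul, inv_mul_cancel₀ ha, Polynomial.C_1]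

lemma LC.ne_zero {G : ℂ[X][X]} (h : LC G) : G ≠ 0 := by
  obtain ⟨a, ha, h⟩ := h
  rintro rfl
  simp at h
  exact ha (Polynomial.C_eq_zero.1 h.symm)

/-- In a quotient where an `LC` polynomial dies, everything is integral. -/
lemma LC.integral {A : Type*} [CommRing A] {G : ℂ[X][X]} (h : LC G) [Algebra ℂ[X] A] (y : A)
    (hy : Polynomial.aeval y G = 0) (F : ℂ[X][X]) :
    IsIntegral ℂ[X] (Polynomial.aeval y F) := by
  obtain ⟨b, hb, hm⟩ := h.monic
  have h1 : IsIntegral ℂ[X] y := ⟨_, hm, by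
    rw [← Polynomial.aeval_def, map_mul, hy, mul_zero]⟩
  exact (adjoin_le_integralClosure h1) (Polynomial.aeval_mem_adjoin_singleton _ _)

/-- In a domain, algebraic over `ℂ` means constant. -/
lemma const_of_root {A : Type*} [CommRing A] [IsDomain A] [Algebra ℂ A] (z : A)
    (D : ℂ[X]) (hD : D ≠ 0) (h : Polynomial.aeval z D = 0) : ∃ c : ℂ, z = algebraMap ℂ A c := by
  have hs := IsAlgClosed.splits D
  rw [Polynomial.Splits.eq_prod_roots hs] at h
  rw [map_mul, Polynomial.aeval_C, mul_eq_zero] at h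
  rcases h with h | h
  · rw [map_eq_zero_iff _ (algebraMap ℂ A).injective] at h
    exact absurd h (Polynomial.leadingCoeff_ne_zero.2 hD)
  · rw [map_multiset_prod, Multiset.prod_eq_zero_iff, Multiset.mem_map] at h
    obtain ⟨q, hq, h⟩ := h
    obtain ⟨c, _, rfl⟩ := Multiset.mem_map.1 hq
    refine ⟨c, ?_⟩
    simpa [sub_eq_zero] using h

/-- Key: on a component of the critical locus, `G` is constant. -/
lemma crit_const_aux {A : Type*} [CommRing A] [IsDomain A] [Algebra ℂ A] [Algebra ℂ[X] A]
    [IsScalarTower ℂ ℂ[X] A] (y : A) (G : ℂ[X][X]) (hG : LC (Polynomial.derivative G))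
    (hx : Polynomial.aeval y (dX G) = 0) (hy : Polynomial.aeval y (Polynomial.derivative G) = 0) :
    ∃ c : ℂ, Polynomial.aeval y G = algebraMap ℂ A c := by
  have hintt : ∀ F : ℂ[X][X], IsIntegral ℂ[X] (Polynomial.aeval y F : A) := by
    intro F
    exact hG.integral y hy F
  let am : ℂ[X] →+* A := algebraMap ℂ[X] A
  by_cases hinj : Function.Injective am
  · have : FaithfulSMul ℂ[X] A := (faithfulSMul_iff_algebraMap_injective ℂ[X] A).2 hinj
    have hyi : IsIntegral ℂ[X] y := by simpa using hintt Polynomial.X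
    set f : A := Polynomial.aeval y G with hf
    have hfi : IsIntegral ℂ[X] f := hintt _
    let D := minpoly ℂ[X] f
    let h := minpoly ℂ[X] y
    have hDG : Polynomial.aeval y (Polynomial.aeval G D) = 0 := by
      have : Polynomial.aeval y (Polynomial.aeval G D) = Polynomial.aeval f D := by
        rw [hf]
        exact (Polynomial.aeval_algHom_apply (Polynomial.aeval y) G D).symm
      rw [this]
      exact minpoly.aeval _ _
    obtain ⟨k, hk⟩ := minpoly.isIntegrallyClosed_dvd hyi hDG
    have hh0 : Polynomial.aeval y (Polynomial.derivative h) ≠ 0 := by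
      intro h0
      have hd := minpoly.isIntegrallyClosed_dvd hyi h0
      have hpos := minpoly.natDegree_pos hyi
      have hdeg : (Polynomial.derivative h).degree < h.degree :=
        Polynomial.degree_derivative_lt (minpoly.ne_zero hyi)
      have := Polynomial.eq_zero_of_dvd_of_degree_lt hd hdeg
      have : (minpoly ℂ[X] y).natDegree = 0 := Polynomial.derivative_eq_zero.1 this
      omega
    have mkx : Polynomial.aeval y (dX G) = 0 := hx
    have mky : Polynomial.aeval y (Polynomial.derivative G) = 0 :=
      hy
    have mkh : Polynomial.aeval y h = 0 := minpoly.aeval _ _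
    have hky : Polynomial.aeval y k = 0 := by
      have e1 := congrArg (fun F => Polynomial.aeval y (Polynomial.derivative F)) hk
      have e2 : Polynomial.derivative (Polynomial.aeval G D) =
          Polynomial.aeval G (Polynomial.derivative D) * Polynomial.derivative G := by
        have hcomp : ∀ E : ℂ[X][X], Polynomial.aeval G E = E.comp G := fun E => rfl
        rw [hcomp, hcomp, Polynomial.derivative_comp]; ring
      simp only [e2, Polynomial.derivative_mul, map_add, map_mul, mky, mul_zero] at e1
      change 0 = _ * _ + Polynomial.aeval y h * _ at e1
      rw [mkh, zero_mul, add_zero] at e1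
      rcases mul_eq_zero.1 e1.symm with h' | h'
      · exact absurd h' hh0
      · exact h'
    have hDx : Polynomial.aeval f (dX D) = 0 := by
      have e1 := congrArg (fun F => Polynomial.aeval y (dX F)) hk
      simp only [dX_aeval, Derivation.leibniz, map_add, map_mul, mkx, mul_zero, smul_eq_mul,
        hky, zero_mul, add_zero] at e1
      change _ = Polynomial.aeval y h * _ at e1
      rw [mkh, zero_mul] at e1
      rw [← e1, hf]
      exact (Polynomial.aeval_algHom_apply (Polynomial.aeval y) G (dX D))
    have hD0 : dX D = 0 := by
      refine Polynomial.eq_zero_of_dvd_of_degree_lt (minpoly.isIntegrallyClosed_dvd hfi hDx) ?_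
      rw [Polynomial.degree_eq_natDegree (minpoly.ne_zero hfi), Polynomial.degree_lt_iff_coeff_zero]
      intro m hm
      rw [dX_coeff]
      rcases hm.eq_or_lt with rfl | hm
      · have : D.coeff (minpoly ℂ[X] f).natDegree = 1 := minpoly.monic hfi
        rw [this]; simp
      · rw [Polynomial.coeff_eq_zero_of_natDegree_lt hm]; simp
    let D0 : ℂ[X] := ∑ i ∈ Finset.range (D.natDegree + 1), Polynomial.monomial i ((D.coeff i).coeff 0)
    have hcoef : ∀ i, D.coeff i = Polynomial.C ((D.coeff i).coeff 0) := by
      intro i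
      apply Polynomial.eq_C_of_derivative_eq_zero
      rw [← dX_coeff, hD0]; simp
    have hDD0 : D = D0.map Polynomial.C := by
      conv_lhs => rw [D.as_sum_range]
      simp only [D0, Polynomial.map_sum, Polynomial.map_monomial]
      exact Finset.sum_congr rfl fun i _ => by rw [← hcoef i]
    refine const_of_root f D0 ?_ ?_
    · intro h0
      rw [h0, Polynomial.map_zero] at hDD0
      exact minpoly.ne_zero hfi hDD0
    · have e : Polynomial.aeval f D = 0 := minpoly.aeval _ _
      rw [hDD0] at e
      rwa [← Polynomial.algebraMap_eq, Polynomial.aeval_map_algebraMap] at e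
  · obtain ⟨p, hp0, hp⟩ : ∃ p : ℂ[X], algebraMap ℂ[X] A p = 0 ∧ p ≠ 0 := by
      by_contra hcon
      push Not at hcon
      exact hinj ((injective_iff_map_eq_zero _).2 hcon)
    have hxi : IsIntegral ℂ (algebraMap ℂ[X] A Polynomial.X) := by
      have : Polynomial.aeval (algebraMap ℂ[X] A Polynomial.X) p = 0 := by
        rw [Polynomial.aeval_algebraMap_apply]
        simpa using hp0
      obtain ⟨c, hc⟩ := const_of_root _ p hp this
      rw [hc]; exact isIntegral_algebraMap
    have hall : ∀ q : ℂ[X], IsIntegral ℂ (algebraMap ℂ[X] A q) := by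
      intro q
      have : IsIntegral ℂ (Polynomial.aeval (algebraMap ℂ[X] A Polynomial.X) q) :=
        (adjoin_le_integralClosure hxi) (Polynomial.aeval_mem_adjoin_singleton _ _)
      rw [Polynomial.aeval_algebraMap_apply] at this
      simpa using this
    have hfin : IsIntegral ℂ (Polynomial.aeval y G : A) := by
      let φ : ℂ[X] →+* integralClosure ℂ A :=
        (algebraMap ℂ[X] A).codRestrict (integralClosure ℂ A) hall
      obtain ⟨D, hD, hD2⟩ := hintt G
      have : IsIntegral (integralClosure ℂ A) (Polynomial.aeval y G) := by
        refine ⟨D.map φ, hD.map φ, ?_⟩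
        rw [Polynomial.eval₂_map]
        exact hD2
      exact isIntegral_trans _ this
    obtain ⟨D, hD, hD2⟩ := hfin
    exact const_of_root _ D hD.ne_zero hD2

lemma crit_const (G : ℂ[X][X]) (hG : LC (Polynomial.derivative G)) (P : Ideal ℂ[X][X])
    [hP : P.IsPrime] (hx : dX G ∈ P) (hy : Polynomial.derivative G ∈ P) :
    ∃ c : ℂ, G - Polynomial.C (Polynomial.C c) ∈ P := by
  let y : ℂ[X][X] ⧸ P := Ideal.Quotient.mk P Polynomial.X
  have hae : ∀ F : ℂ[X][X], Polynomial.aeval y F = Ideal.Quotient.mk P F := by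
    intro F
    have : (Polynomial.aeval y : ℂ[X][X] →ₐ[ℂ[X]] (ℂ[X][X] ⧸ P)) = Ideal.Quotient.mkₐ ℂ[X] P := by
      apply Polynomial.algHom_ext
      simp [y]
    rw [this]; rfl
  obtain ⟨c, hc⟩ := crit_const_aux y G hG (by rw [hae]; exact Ideal.Quotient.eq_zero_iff_mem.2 hx)
    (by rw [hae]; exact Ideal.Quotient.eq_zero_iff_mem.2 hy)
  refine ⟨c, ?_⟩
  rw [← Ideal.Quotient.eq_zero_iff_mem, map_sub, ← hae, hc, sub_eq_zero,
    IsScalarTower.algebraMap_apply ℂ ℂ[X][X] (ℂ[X][X] ⧸ P)]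
  rfl

end algebra2

section algebra3
open Set Metric
open scoped Polynomial

/-- Finitely many critical values. -/
lemma crit_finite (G : ℂ[X][X]) (hG : LC (Polynomial.derivative G)) :
    ∃ A : Set ℂ, A.Finite ∧ ∀ x y : ℂ, (dX G).evalEval x y = 0 →
      (Polynomial.derivative G).evalEval x y = 0 → G.evalEval x y ∈ A := by
  let I : Ideal ℂ[X][X] := Ideal.span {dX G, Polynomial.derivative G}
  have hfin := I.finite_minimalPrimes_of_isNoetherianRing
  have hc : ∀ P : Ideal ℂ[X][X], P ∈ I.minimalPrimes →
      ∃ c : ℂ, G - Polynomial.C (Polynomial.C c) ∈ P := by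
    intro P hP
    have hp : P.IsPrime := hP.1.1
    have hIP : I ≤ P := hP.1.2
    exact crit_const G hG P (hIP (Ideal.subset_span (by simp))) (hIP (Ideal.subset_span (by simp)))
  choose! c hc using hc
  refine ⟨c '' I.minimalPrimes, hfin.image c, fun x y hx hy => ?_⟩
  have hpr : (RingHom.ker (Polynomial.evalEvalRingHom x y)).IsPrime := RingHom.ker_isPrime _
  have hle : I ≤ RingHom.ker (Polynomial.evalEvalRingHom x y) := by
    rw [Ideal.span_le]
    rintro F (rfl | rfl)
    · exact hx
    · exact hy
  obtain ⟨P, hP, hPle⟩ := Ideal.exists_minimalPrimes_le hle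
  refine ⟨P, hP, ?_⟩
  have h : (G - Polynomial.C (Polynomial.C (c P))).evalEval x y = 0 := hPle (hc P hP)
  rw [Polynomial.evalEval_sub, Polynomial.evalEval_C, Polynomial.eval_C, sub_eq_zero] at h
  exact h.symm

lemma evalEval_aeval (G D : ℂ[X][X]) (x y : ℂ) :
    (Polynomial.aeval G D : ℂ[X][X]).evalEval x y = D.evalEval x (G.evalEval x y) := by
  rw [← Polynomial.coe_evalEvalRingHom, Polynomial.aeval_def, Polynomial.hom_eval₂,
    Polynomial.coe_evalEvalRingHom, ← Polynomial.eval₂_evalRingHom]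
  congr 1
  ext <;> simp

lemma esc_finite (G : ℂ[X][X]) (hG : LC (Polynomial.derivative G)) :
    ∃ A : Set ℂ, A.Finite ∧ ∀ K : Set ℂ, IsCompact K → K ⊆ Aᶜ → ∃ R : ℝ, ∀ x y : ℂ,
      G.evalEval x y ∈ K → R < ‖x‖ → (Polynomial.derivative G).evalEval x y ≠ 0 := by
  obtain ⟨D, hD, hDv⟩ : ∃ D : ℂ[X][X], D ≠ 0 ∧ ∀ x y : ℂ,
      (Polynomial.derivative G).evalEval x y = 0 → D.evalEval x (G.evalEval x y) = 0 := by
    obtain ⟨D, hD, hD2⟩ := hG.integral (AdjoinRoot.root (Polynomial.derivative G))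
      (by rw [AdjoinRoot.aeval_eq, AdjoinRoot.mk_self]) G
    refine ⟨D, hD.ne_zero, fun x y hxy => ?_⟩
    rw [← Polynomial.aeval_def, Polynomial.aeval_algHom_apply, AdjoinRoot.aeval_eq,
      AdjoinRoot.mk_eq_zero] at hD2
    have := Polynomial.evalEval_dvd x y hD2
    rw [evalEval_aeval, hxy, zero_dvd_iff] at this
    exact this
  let S : ℂ[X][X] := Polynomial.Bivariate.swap D
  have hS : S ≠ 0 := by
    intro h
    exact hD ((map_eq_zero_iff _ (Polynomial.Bivariate.swap (R := ℂ)).injective).1 h)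
  have hSe : ∀ x c : ℂ, S.evalEval c x = D.evalEval x c := by
    intro x c
    have := Polynomial.Bivariate.aevalAeval_swap c x D
    rwa [Polynomial.coe_aevalAeval_eq_evalEval, Polynomial.coe_aevalAeval_eq_evalEval] at this
  have hq : S.leadingCoeff ≠ 0 := Polynomial.leadingCoeff_ne_zero.2 hS
  refine ⟨S.leadingCoeff.rootSet ℂ, Polynomial.rootSet_finite _ _, fun K hK hKA => ?_⟩
  have hqK : ∀ c ∈ K, S.leadingCoeff.eval c ≠ 0 := by
    intro c hc h
    exact hKA hc (by rw [Polynomial.mem_rootSet]; exact ⟨hq, by simpa using h⟩)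
  obtain ⟨R, hR⟩ := root_bound K hK (fun c => S.map (Polynomial.evalRingHom c)) S.natDegree
    (fun c hc => Polynomial.natDegree_map_of_leadingCoeff_ne_zero _ (hqK c hc))
    (fun c hc h => hqK c hc (by
      have := congrArg (fun F => Polynomial.coeff F S.natDegree) h
      simpa using this))
    (fun i => by
      simp only [Polynomial.coeff_map, Polynomial.coe_evalRingHom]
      exact (Polynomial.continuous _).continuousOn)
  refine ⟨R, fun x y hK hRx h => ?_⟩
  have := hR _ hK x (by rw [Polynomial.map_evalRingHom_eval, hSe]; exact hDv x y h)
  linarith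

lemma prop_bound (G : ℂ[X][X]) (hG : LC G) (hn : G.natDegree ≠ 0) (K : Set ℂ) (hK : IsCompact K)
    (X : ℝ) : ∃ Y : ℝ, ∀ x y : ℂ, G.evalEval x y ∈ K → ‖x‖ ≤ X → ‖y‖ ≤ Y := by
  obtain ⟨a, ha, hGa⟩ := hG
  have hco : ∀ z : ℂ × ℂ, (G.map (Polynomial.evalRingHom z.1) - Polynomial.C z.2).coeff G.natDegree
      = a := by
    intro z
    rw [Polynomial.coeff_sub, Polynomial.coeff_C_of_ne_zero hn, Polynomial.coeff_map,
      Polynomial.coeff_natDegree, hGa]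
    simp
  obtain ⟨R, hR⟩ := root_bound (closedBall (0 : ℂ) X ×ˢ K) ((isCompact_closedBall _ _).prod hK)
    (fun z => G.map (Polynomial.evalRingHom z.1) - Polynomial.C z.2) G.natDegree
    (fun z _ => by
      apply Polynomial.natDegree_eq_of_le_of_coeff_ne_zero
      · refine (Polynomial.natDegree_sub_le _ _).trans ?_
        simp [Polynomial.natDegree_map_le]
      · rw [hco]; exact ha)
    (fun z _ h => ha (by rw [← hco z, h, Polynomial.coeff_zero]))
    (fun i => by
      simp only [Polynomial.coeff_sub, Polynomial.coeff_map, Polynomial.coe_evalRingHom,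
        Polynomial.coeff_C]
      apply Continuous.continuousOn
      refine ((Polynomial.continuous _).comp continuous_fst).sub ?_
      split_ifs
      · exact continuous_snd
      · exact continuous_const)
  refine ⟨R, fun x y hxy hx => ?_⟩
  refine hR (x, G.evalEval x y) ⟨by simpa using hx, hxy⟩ y ?_
  simp [Polynomial.map_evalRingHom_eval]

theorem tame_of_LC (G : ℂ[X][X]) (hG : LC G) (hG' : LC (Polynomial.derivative G))
    (hn : G.natDegree ≠ 0) : ∃ A : Set ℂ, A.Finite ∧
      Tame (fun p => G.evalEval p.1 p.2) (fun p => (dX G).evalEval p.1 p.2)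
        (fun p => (Polynomial.derivative G).evalEval p.1 p.2) Aᶜ := by
  obtain ⟨A₁, h₁, hA₁⟩ := crit_finite G hG'
  obtain ⟨A₂, h₂, hA₂⟩ := esc_finite G hG'
  refine ⟨A₁ ∪ A₂, h₁.union h₂, ?_, ?_, ?_, ?_, ?_, ?_, ?_⟩
  · exact (eval_contDiff _).restrict_scalars ℝ
  · exact (eval_contDiff _).restrict_scalars ℝ
  · exact (eval_contDiff _).restrict_scalars ℝ
  · exact eval_hasFDerivAt G
  · intro p hp
    by_contra hcon
    push Not at hcon
    exact hp (Or.inl (hA₁ _ _ hcon.1 hcon.2))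
  · intro D hD hDA
    obtain ⟨R, hR⟩ := hA₂ D hD (fun w hw h => hDA hw (Or.inr h))
    exact ⟨R, fun p => hR _ _⟩
  · intro D hD X
    obtain ⟨Y, hY⟩ := prop_bound G hG hn D hD X
    exact ⟨Y, fun p => hY _ _⟩

lemma Tame.smul {g gx gy : ℂ × ℂ → ℂ} {O : Set ℂ} (T : Tame g gx gy O) (u : ℂ) (hu : u ≠ 0) :
    Tame (fun p => u * g p) (fun p => u * gx p) (fun p => u * gy p) {w | u⁻¹ * w ∈ O} := by
  refine ⟨contDiff_const.mul T.hg, contDiff_const.mul T.hx, contDiff_const.mul T.hy, ?_, ?_, ?_, ?_⟩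
  · intro p
    have := (T.hd p).const_mul u
    simpa only [smul_add, smul_smul] using this
  · intro p hp
    simp only [mem_ofPred_eq, inv_mul_cancel_left₀ hu] at hp
    simpa [hu] using T.crit p hp
  · intro D hD hDO
    obtain ⟨R, hR⟩ := T.esc ((fun w => u⁻¹ * w) '' D) (hD.image (by fun_prop)) (by
      rintro _ ⟨w, hw, rfl⟩; exact hDO hw)
    refine ⟨R, fun p hp h => mul_ne_zero hu (hR p ⟨_, hp, ?_⟩ h)⟩
    simp [inv_mul_cancel_left₀ hu]
  · intro D hD X
    obtain ⟨Y, hY⟩ := T.prop ((fun w => u⁻¹ * w) '' D) (hD.image (by fun_prop)) X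
    refine ⟨Y, fun p hp h => hY p ⟨_, hp, ?_⟩ h⟩
    simp [inv_mul_cancel_left₀ hu]

end algebra3

section coords
open Set Metric
open scoped Polynomial

lemma LC.of_coeff (G : ℂ[X][X]) (n : ℕ) (a : ℂ) (ha : a ≠ 0) (hn : G.natDegree ≤ n)
    (h : G.coeff n = Polynomial.C a) : G.natDegree = n ∧ LC G := by
  have h1 : G.natDegree = n := Polynomial.natDegree_eq_of_le_of_coeff_ne_zero hn (by
    rw [h]; simpa using ha)
  refine ⟨h1, a, ha, ?_⟩
  rw [Polynomial.leadingCoeff, h1, h]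

/-- After a triangular change of coordinates the polynomial becomes monic-like in `y`. -/
lemma exists_coords (f : MvPolynomial (Fin 2) ℂ) (hf : f.totalDegree ≠ 0) :
    ∃ (G : ℂ[X][X]) (N : ℕ), LC G ∧ LC (Polynomial.derivative G) ∧ G.natDegree ≠ 0 ∧
      ∀ x y : ℂ, G.evalEval x y = eval ![x + y ^ N, y] f := by
  classical
  set N := f.totalDegree + 1 with hN
  let m : Fin 2 → ℂ[X][X] := ![Polynomial.C Polynomial.X + Polynomial.X ^ N, Polynomial.X]
  let G : ℂ[X][X] := aeval m f
  have hval : ∀ x y : ℂ, G.evalEval x y = eval ![x + y ^ N, y] f := by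
    intro x y
    have h1 : (Polynomial.evalEvalRingHom x y).comp (aeval m : MvPolynomial (Fin 2) ℂ →ₐ[ℂ] ℂ[X][X]).toRingHom =
        eval ![x + y ^ N, y] := by
      apply MvPolynomial.ringHom_ext
      · intro r
        simp [Polynomial.algebraMap_apply]
      · intro i
        fin_cases i <;> simp [m]
    exact congrArg (fun φ : MvPolynomial (Fin 2) ℂ →+* ℂ => φ f) h1
  let M : (Fin 2 →₀ ℕ) → ℂ[X][X] := fun s =>
    (Polynomial.C Polynomial.X + Polynomial.X ^ N) ^ (s 0) * Polynomial.X ^ (s 1)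
  let d : (Fin 2 →₀ ℕ) → ℕ := fun s => s 0 * N + s 1
  have hmon : (Polynomial.X ^ N + Polynomial.C Polynomial.X : ℂ[X][X]).Monic :=
    Polynomial.monic_X_pow_add_C _ (by omega)
  have hMm : ∀ s, (M s).Monic := by
    intro s
    simp only [M]
    rw [add_comm]
    exact (hmon.pow _).mul (Polynomial.monic_X_pow _)
  have hMd : ∀ s, (M s).natDegree = d s := by
    intro s
    simp only [M, d]
    rw [add_comm (Polynomial.C Polynomial.X), (hmon.pow _).natDegree_mul (Polynomial.monic_X_pow _),
      hmon.natDegree_pow, Polynomial.natDegree_X_pow_add_C, Polynomial.natDegree_X_pow]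
  have hGs : G = ∑ s ∈ f.support, Polynomial.C (Polynomial.C (f.coeff s)) * M s := by
    simp only [G]
    rw [MvPolynomial.aeval_def, MvPolynomial.eval₂_eq']
    refine Finset.sum_congr rfl fun s _ => ?_
    simp only [Fin.prod_univ_two, m, M]
    rfl
  have hs1 : ∀ s ∈ f.support, s 1 < N := by
    intro s hs
    have := MvPolynomial.le_totalDegree hs
    have h2 : s 1 ≤ s.sum fun _ e => e := by
      rw [Finsupp.sum_fintype _ _ (fun _ => rfl), Fin.sum_univ_two]; omega
    omega
  have hinj : ∀ s ∈ f.support, ∀ t ∈ f.support, d s = d t → s = t := by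
    intro s hs t ht h
    have a1 := hs1 s hs
    have a2 := hs1 t ht
    simp only [d] at h
    have e1 : s 1 = t 1 := by
      have := congrArg (· % N) h
      simpa [Nat.add_mod, Nat.mod_eq_of_lt a1, Nat.mod_eq_of_lt a2] using this
    have e0 : s 0 = t 0 := by
      rw [e1] at h
      exact Nat.eq_of_mul_eq_mul_right (by omega) (Nat.add_right_cancel h)
    ext i
    fin_cases i
    · exact e0
    · exact e1
  obtain ⟨s₀, hs₀, hs₀p⟩ : ∃ s ∈ f.support, 1 ≤ d s := by
    by_contra hcon
    push Not at hcon
    apply hf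
    rw [MvPolynomial.totalDegree_eq_zero_iff]
    intro s hs i
    have := hcon s hs
    simp only [d] at this
    have hpos : s 0 = 0 := by
      by_contra h0
      have : 1 ≤ s 0 * N := Nat.mul_pos (by omega) (by omega)
      omega
    fin_cases i
    · exact hpos
    · show s 1 = 0
      omega
  obtain ⟨t, ht, htmax⟩ := f.support.exists_max_image d ⟨s₀, hs₀⟩
  have htp : 1 ≤ d t := hs₀p.trans (htmax s₀ hs₀)
  have ha : f.coeff t ≠ 0 := MvPolynomial.mem_support_iff.1 ht
  have hGc : G.coeff (d t) = Polynomial.C (f.coeff t) := by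
    rw [hGs, Polynomial.finsetSum_coeff, Finset.sum_eq_single_of_mem t ht]
    · rw [Polynomial.coeff_C_mul, ← hMd, Polynomial.coeff_natDegree, hMm t, mul_one]
    · intro s hs hst
      rw [Polynomial.coeff_C_mul, Polynomial.coeff_eq_zero_of_natDegree_lt, mul_zero]
      rw [hMd]
      exact lt_of_le_of_ne (htmax s hs) fun h => hst (hinj s hs t ht h)
  have hGd : G.natDegree ≤ d t := by
    rw [hGs]
    refine Polynomial.natDegree_sum_le_of_forall_le _ _ fun s hs => ?_
    refine (Polynomial.natDegree_C_mul_le _ _).trans ?_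
    rw [hMd]
    exact htmax s hs
  obtain ⟨h1, h2⟩ := LC.of_coeff G (d t) _ ha hGd hGc
  refine ⟨G, N, h2, ?_, by omega, hval⟩
  refine (LC.of_coeff _ (d t - 1) (f.coeff t * (d t : ℂ)) (mul_ne_zero ha (by
    exact_mod_cast (by omega : d t ≠ 0))) ?_ ?_).2
  · exact (Polynomial.natDegree_derivative_le _).trans (by omega)
  · rw [Polynomial.coeff_derivative, Nat.sub_add_cancel htp, hGc]
    have : ((d t - 1 : ℕ) : ℂ[X]) + 1 = (d t : ℂ[X]) := by
      exact_mod_cast congrArg (Nat.cast (R := ℂ[X])) (Nat.sub_add_cancel htp)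
    rw [this]
    simp

/-- The triangular homeomorphism. -/
def triHomeo (N : ℕ) : (Fin 2 → ℂ) ≃ₜ ℂ × ℂ where
  toFun v := (v 0 - v 1 ^ N, v 1)
  invFun p := ![p.1 + p.2 ^ N, p.2]
  left_inv v := by
    ext i
    fin_cases i <;> simp
  right_inv p := by simp
  continuous_toFun := by fun_prop
  continuous_invFun := by
    refine continuous_pi fun i => ?_
    fin_cases i
    · show Continuous fun p : ℂ × ℂ => p.1 + p.2 ^ N
      fun_prop
    · show Continuous fun p : ℂ × ℂ => p.2
      fun_prop

lemma Slit.pre (f : MvPolynomial (Fin 2) ℂ) (hf : f.totalDegree ≠ 0) :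
    ∃ A : Set ℂ, A.Finite ∧ ∀ (r : ℕ) (u : ℂ), u ≠ 0 → ∀ (c : Fin r → ℂ),
      (∀ i w, w.im = (c i).im → (c i).re ≤ w.re → u⁻¹ * w ∉ A) →
      Pushable {v : Fin 2 → ℂ | u * eval v f ∈ Slit c} := by
  obtain ⟨G, N, h1, h2, h3, h4⟩ := exists_coords f hf
  obtain ⟨A, hA, T⟩ := tame_of_LC G h1 h2 h3
  refine ⟨A, hA, fun r u hu c hc => ?_⟩
  have hO : IsOpen {w : ℂ | u⁻¹ * w ∈ Aᶜ} :=
    hA.isClosed.isOpen_compl.preimage (by fun_prop : Continuous fun w : ℂ => u⁻¹ * w)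
  have := (Pushable.homeo (triHomeo N) _ ((T.smul u hu).pushable hO c hc))
  convert this using 1
  ext v
  have : eval v f = G.evalEval (triHomeo N v).1 (triHomeo N v).2 := by
    rw [h4]
    congr 1
    have := (triHomeo N).symm_apply_apply v
    exact congrArg _ this.symm
  simp only [mem_preimage, mem_ofPred_eq, this]

end coords

section assembly
open Set Metric Filter Topology
open scoped Polynomial

/-- Preimages of connected open sets are connected. -/
lemma conn_preimage {E : Type*} [TopologicalSpace E] (H : E → ℂ) (hc : Continuous H)
    (ho : IsOpenMap H) (hs : Function.Surjective H) (A : Set ℂ) (hA : A.Finite)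
    (hf : ∀ c, c ∉ A → IsConnected {v | H v = c}) (Ω : Set ℂ) (hΩ : IsOpen Ω)
    (hΩc : IsPreconnected Ω) : IsPreconnected (H ⁻¹' Ω) := by
  intro u v hu hv huv hnu hnv
  have hso := hΩ.preimage hc
  by_contra hcon
  have o1 : IsOpen (H '' (H ⁻¹' Ω ∩ u)) := ho _ (hso.inter hu)
  have o2 : IsOpen (H '' (H ⁻¹' Ω ∩ v)) := ho _ (hso.inter hv)
  have key : ¬ (H '' (H ⁻¹' Ω ∩ u) ∩ H '' (H ⁻¹' Ω ∩ v)).Nonempty := by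
    intro hne
    have hd : Dense Aᶜ := hA.countable.dense_compl ℝ
    obtain ⟨c, ⟨⟨a, ⟨ha, hau⟩, rfl⟩, ⟨b, ⟨hb, hbv⟩, hba⟩⟩, hcA⟩ :=
      hd.inter_open_nonempty _ (o1.inter o2) hne
    have hsub : {v | H v = H a} ⊆ H ⁻¹' Ω := by
      intro z hz
      have hz' : H z = H a := hz
      rw [mem_preimage, hz']; exact ha
    obtain ⟨z, hz, hzuv⟩ := (hf _ hcA).2 u v hu hv (hsub.trans huv) ⟨a, rfl, hau⟩ ⟨b, hba, hbv⟩
    exact hcon ⟨z, hsub hz, hzuv⟩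
  have hcov : Ω ⊆ H '' (H ⁻¹' Ω ∩ u) ∪ H '' (H ⁻¹' Ω ∩ v) := by
    intro w hw
    obtain ⟨z, rfl⟩ := hs w
    rcases huv hw with h | h
    · exact Or.inl ⟨z, ⟨hw, h⟩, rfl⟩
    · exact Or.inr ⟨z, ⟨hw, h⟩, rfl⟩
  obtain ⟨a, ha, hau⟩ := hnu
  obtain ⟨b, hb, hbv⟩ := hnv
  obtain ⟨w, -, hw⟩ := hΩc _ _ o1 o2 hcov ⟨H a, ha, a, ⟨ha, hau⟩, rfl⟩ ⟨H b, hb, b, ⟨hb, hbv⟩, rfl⟩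
  exact key ⟨w, hw⟩

lemma Slit.isOpen {r : ℕ} (c : Fin r → ℂ) : IsOpen (Slit c) := by
  have : Slit c = ⋂ i, {w : ℂ | w.im = (c i).im ∧ (c i).re ≤ w.re}ᶜ := by
    ext w
    simp [Slit]
  rw [this]
  refine isOpen_iInter_of_finite fun i => isOpen_compl_iff.2 ?_
  exact (isClosed_eq Complex.continuous_im continuous_const).inter
    (isClosed_le continuous_const Complex.continuous_re)

lemma Slit.exists_left {r : ℕ} (c : Fin r → ℂ) : ∃ m : ℝ, ∀ i, m < (c i).re := by
  have : ∀ᶠ t : ℝ in atBot, ∀ i, t < (c i).re := eventually_all.2 fun i => eventually_lt_atBot _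
  exact this.exists

lemma Slit.isConnected {r : ℕ} (c : Fin r → ℂ) : IsConnected (Slit c) := by
  obtain ⟨m, hm⟩ := Slit.exists_left c
  have hH : {w : ℂ | w.re ≤ m} ⊆ Slit c := by
    intro w hw i h
    have hw' : w.re ≤ m := hw
    linarith [hm i, h.2]
  have h0 : (m : ℂ) ∈ {w : ℂ | w.re ≤ m} := by simp
  refine ⟨⟨m, hH h0⟩, isPreconnected_of_forall (m : ℂ) fun w hw => ?_⟩
  let w' : ℂ := ⟨min m w.re, w.im⟩
  refine ⟨{w : ℂ | w.re ≤ m} ∪ segment ℝ w' w, union_subset hH ?_, Or.inl h0,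
    Or.inr (right_mem_segment _ _ _), ?_⟩
  · rintro z ⟨a, b, ha, hb, hab, rfl⟩ i h
    have him : (a • w' + b • w).im = w.im := by
      simp only [Complex.add_im, Complex.real_smul, Complex.mul_im, Complex.ofReal_re,
        Complex.ofReal_im, w']
      linear_combination w.im * hab
    have hre : (a • w' + b • w).re ≤ w.re := by
      simp only [Complex.add_re, Complex.real_smul, Complex.mul_re, Complex.ofReal_re,
        Complex.ofReal_im, w']
      have := mul_le_mul_of_nonneg_left (min_le_right m w.re) ha
      have e : a * w.re + b * w.re = w.re := by rw [← add_mul, hab, one_mul]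
      linarith
    exact hw i ⟨him ▸ h.1, h.2.trans hre⟩
  · refine IsPreconnected.union w' ?_ (left_mem_segment _ _ _) ?_ ?_
    · show min m w.re ≤ m
      exact min_le_left _ _
    · exact (convex_halfSpace_re_le m).isPreconnected
    · exact (convex_segment _ _).isPreconnected

/-- The open intervals between the heights. -/
def gap {r : ℕ} (y : Fin r → ℝ) : Option (Fin r) → Set ℝ
  | none => {t | ∀ j, t < y j}
  | some i => {t | y i < t ∧ ∀ j, y i < y j → t < y j}

lemma gap_isOpen {r : ℕ} (y : Fin r → ℝ) (o : Option (Fin r)) : IsOpen (gap y o) := by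
  cases o with
  | none =>
    have : gap y none = ⋂ j, Iio (y j) := by ext t; simp [gap]
    rw [this]
    exact isOpen_iInter_of_finite fun i => isOpen_Iio
  | some i =>
    have : gap y (some i) = Ioi (y i) ∩ ⋂ j, {t | y i < y j → t < y j} := by ext t; simp [gap]
    rw [this]
    refine isOpen_Ioi.inter (isOpen_iInter_of_finite fun j => ?_)
    by_cases h : y i < y j
    · simp only [h, true_imp_iff]; exact isOpen_Iio
    · simp [h]

lemma gap_nonempty {r : ℕ} (y : Fin r → ℝ) (o : Option (Fin r)) : (gap y o).Nonempty := by
  cases o with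
  | none =>
    have : ∀ᶠ t : ℝ in atBot, ∀ j, t < y j := eventually_all.2 fun i => eventually_lt_atBot _
    exact this.exists
  | some i =>
    have h1 : ∀ᶠ t : ℝ in 𝓝[>] (y i), y i < t := self_mem_nhdsWithin
    have h2 : ∀ᶠ t : ℝ in 𝓝[>] (y i), ∀ j, y i < y j → t < y j := by
      refine eventually_all.2 fun j => ?_
      by_cases h : y i < y j
      · filter_upwards [nhdsWithin_le_nhds (Iio_mem_nhds h)] with t ht _ using ht
      · exact Eventually.of_forall fun t h' => absurd h' h
    exact (h1.and h2).exists

lemma gap_convex {r : ℕ} (y : Fin r → ℝ) (o : Option (Fin r)) : Convex ℝ (gap y o) := by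
  apply Set.OrdConnected.convex
  cases o with
  | none => exact ⟨fun a ha b hb t ht j => ht.2.trans_lt (hb j)⟩
  | some i =>
    exact ⟨fun a ha b hb t ht => ⟨ha.1.trans_le ht.1, fun j hj => ht.2.trans_lt (hb.2 j hj)⟩⟩

lemma gap_disj {r : ℕ} (y : Fin r → ℝ) (hy : Function.Injective y) (o o' : Option (Fin r)) (t : ℝ)
    (h : t ∈ gap y o) (h' : t ∈ gap y o') : o = o' := by
  cases o with
  | none =>
    cases o' with
    | none => rfl
    | some i => exact absurd (h i) (not_lt.2 h'.1.le)
  | some i =>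
    cases o' with
    | none => exact absurd (h' i) (not_lt.2 h.1.le)
    | some j =>
      congr 1
      apply hy
      apply le_antisymm
      · by_contra hlt
        exact absurd (h'.2 i (not_le.1 hlt)) (not_lt.2 h.1.le)
      · by_contra hlt
        exact absurd (h.2 j (not_le.1 hlt)) (not_lt.2 h'.1.le)

lemma gap_cover {r : ℕ} (y : Fin r → ℝ) (t : ℝ) : (∀ j, t ≠ y j) ↔ ∃ o, t ∈ gap y o := by
  classical
  constructor
  · intro h
    by_cases hex : ∃ j, y j < t
    · obtain ⟨j₀, hj₀⟩ := hex
      obtain ⟨i, hi, hmax⟩ := (Finset.univ.filter fun j => y j < t).exists_max_image y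
        ⟨j₀, by simpa using hj₀⟩
      simp only [Finset.mem_filter, Finset.mem_univ, true_and] at hi hmax
      refine ⟨some i, hi, fun j hj => ?_⟩
      by_contra hcon
      have h1 : y j < t := lt_of_le_of_ne (not_lt.1 hcon) (h j).symm
      exact absurd (hmax j h1) (not_le.2 hj)
    · push Not at hex
      exact ⟨none, fun j => lt_of_le_of_ne (hex j) (h j)⟩
  · rintro ⟨o, ho⟩ j rfl
    cases o with
    | none => exact lt_irrefl _ (ho j)
    | some i => exact lt_irrefl _ (ho.2 j ho.1)

/-- A generic direction. -/
lemma exists_dir (B : Set ℂ) (hB : B.Finite) :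
    ∃ u : ℂ, u ≠ 0 ∧ ∀ a ∈ B, ∀ b ∈ B, (u * a).im = (u * b).im → a = b := by
  have hfin : ((fun p : ℂ × ℂ => -(p.1 - p.2).re / (p.1 - p.2).im) '' (B ×ˢ B)).Finite :=
    (hB.prod hB).image _
  obtain ⟨t, ht⟩ := hfin.exists_notMem
  refine ⟨⟨t, 1⟩, fun h => by simpa using congrArg Complex.im h, fun a ha b hb hab => ?_⟩
  simp only [Complex.mul_im] at hab
  have e : t * (a - b).im + (a - b).re = 0 := by
    simp only [Complex.sub_im, Complex.sub_re]; linarith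
  by_cases him : (a - b).im = 0
  · rw [him] at e
    have : a - b = 0 := Complex.ext (by simpa using e) him
    exact sub_eq_zero.1 this
  · exfalso
    refine ht ⟨(a, b), ⟨ha, hb⟩, ?_⟩
    show -(a - b).re / (a - b).im = t
    rw [div_eq_iff him]; linarith

lemma eval_surj (f : MvPolynomial (Fin 2) ℂ) (hf : f.totalDegree ≠ 0) :
    Function.Surjective fun v : Fin 2 → ℂ => eval v f := by
  intro c
  obtain ⟨G, N, ⟨a, ha, hG⟩, -, hn, hv⟩ := exists_coords f hf
  have hco : (G.map (Polynomial.evalRingHom 0) - Polynomial.C c).coeff G.natDegree = a := by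
    rw [Polynomial.coeff_sub, Polynomial.coeff_C_of_ne_zero hn, Polynomial.coeff_map,
      Polynomial.coeff_natDegree, hG]
    simp
  have hdeg : (G.map (Polynomial.evalRingHom 0) - Polynomial.C c).degree ≠ 0 := by
    intro h
    have h1 := Polynomial.natDegree_eq_of_degree_eq_some h
    rw [Polynomial.coeff_eq_zero_of_natDegree_lt (by rw [h1]; exact Nat.pos_of_ne_zero hn)] at hco
    exact ha hco.symm
  obtain ⟨y, hy⟩ := IsAlgClosed.exists_root _ hdeg
  refine ⟨![0 + y ^ N, y], ?_⟩
  have hy' : (G.map (Polynomial.evalRingHom 0) - Polynomial.C c).eval y = 0 := hy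
  rw [Polynomial.eval_sub, Polynomial.map_evalRingHom_eval, Polynomial.eval_C, hv, sub_eq_zero] at hy'
  exact hy'

lemma eval_isOpenMap (f : MvPolynomial (Fin 2) ℂ) (hf : f.totalDegree ≠ 0) :
    IsOpenMap fun v : Fin 2 → ℂ => eval v f := by
  have han : AnalyticOnNhd ℂ (fun v : Fin 2 → ℂ => eval v f) univ :=
    AnalyticOnNhd.eval_mvPolynomial f
  rcases han.is_constant_or_isOpenMap with ⟨w, hw⟩ | h
  · exfalso
    obtain ⟨v, hv⟩ := eval_surj f hf (w + 1)
    have := hw v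
    simp only at hv
    rw [hv] at this
    simp at this
  · exact h

lemma pathConn (f : MvPolynomial (Fin 2) ℂ) (hf : f.totalDegree ≠ 0)
    (A₀ : Set ℂ) (hA₀ : A₀.Finite)
    (hA₀c : ∀ c : ℂ, c ∉ A₀ → IsConnected {v : Fin 2 → ℂ | eval v f = c})
    (u : ℂ) (hu : u ≠ 0) (Ω : Set ℂ) (hΩ : IsOpen Ω) (hΩc : IsConnected Ω) :
    IsPathConnected {v : Fin 2 → ℂ | u * eval v f ∈ Ω} := by
  have hcont : Continuous fun v : Fin 2 → ℂ => eval v f := MvPolynomial.continuous_eval f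
  have hpc := conn_preimage (fun v : Fin 2 → ℂ => u * eval v f) (continuous_const.mul hcont)
    ((Homeomorph.mulLeft₀ u hu).isOpenMap.comp (eval_isOpenMap f hf))
    ((Homeomorph.mulLeft₀ u hu).surjective.comp (eval_surj f hf))
    ((fun w => u * w) '' A₀) (hA₀.image _) (by
      intro c hc
      have := hA₀c (u⁻¹ * c) (fun h => hc ⟨_, h, by simp [mul_inv_cancel_left₀ hu]⟩)
      convert this using 1
      ext v
      exact (eq_inv_mul_iff_mul_eq₀ hu).symm) Ω hΩ hΩc.2
  obtain ⟨w, hw⟩ := hΩc.1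
  obtain ⟨v, hv⟩ := eval_surj f hf (u⁻¹ * w)
  have hv' : eval v f = u⁻¹ * w := hv
  have hne : {v : Fin 2 → ℂ | u * eval v f ∈ Ω}.Nonempty := by
    refine ⟨v, ?_⟩
    show u * eval v f ∈ Ω
    rw [hv', mul_inv_cancel_left₀ hu]
    exact hw
  have hop : IsOpen {v : Fin 2 → ℂ | u * eval v f ∈ Ω} := hΩ.preimage (continuous_const.mul hcont)
  exact hop.isConnected_iff_isPathConnected.1 ⟨hne, hpc⟩

end assembly

/-- If `f ∈ ℂ[x,y]` is a nonconstant primitive polynomial (its generic fibers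
are connected), then the complement in `ℂ²` of a union of `r` distinct generic fibers of `f`
has free fundamental group of rank `r`. -/
theorem stmt_7 (f : MvPolynomial (Fin 2) ℂ) (hf : f.totalDegree ≠ 0)
    (hconn : ∃ A₀ : Set ℂ, A₀.Finite ∧ ∀ c : ℂ, c ∉ A₀ →
      IsConnected {v : Fin 2 → ℂ | eval v f = c}) :
    ∃ A : Set ℂ, A.Finite ∧
      ∀ (r : ℕ), 1 ≤ r → ∀ c : Fin r → ℂ, Function.Injective c → (∀ i, c i ∉ A) →
        ∀ x : ↥(⋃ i, {v : Fin 2 → ℂ | eval v f = c i})ᶜ,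
          Nonempty (FundamentalGroup (↥(⋃ i, {v : Fin 2 → ℂ | eval v f = c i})ᶜ) x ≃*
            FreeGroup (Fin r)) := by
  obtain ⟨A₀, hA₀, hA₀c⟩ := hconn
  obtain ⟨A, hA, hpush⟩ := Slit.pre f hf
  refine ⟨A, hA, fun r _ c hcinj hcA x => ?_⟩
  obtain ⟨u, hu, hdir⟩ := exists_dir (A ∪ Set.range c) (hA.union (Set.finite_range c))
  have hcont : Continuous fun v : Fin 2 → ℂ => eval v f := MvPolynomial.continuous_eval f
  let U : Set (Fin 2 → ℂ) := (⋃ i, {v : Fin 2 → ℂ | eval v f = c i})ᶜ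
  have hUmem : ∀ v, v ∈ U ↔ ∀ i, eval v f ≠ c i := by
    intro v
    simp [U]
  let y : Fin r → ℝ := fun i => (u * c i).im
  have hy : Function.Injective y := fun i j hij =>
    hcinj (hdir _ (Or.inr ⟨i, rfl⟩) _ (Or.inr ⟨j, rfl⟩) hij)
  let s : Bool → ℂ := fun b => if b then u else -u
  have hs : ∀ b, s b ≠ 0 := by
    intro b; cases b <;> simp [s, hu]
  let W : Bool → Set (Fin 2 → ℂ) := fun b => {v | s b * eval v f ∈ Slit fun i => s b * c i}
  have hWU : ∀ b, W b ⊆ U := by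
    intro b v hv
    rw [hUmem]
    intro i hi
    have hv' : s b * eval v f ∈ Slit fun i => s b * c i := hv
    exact hv' i (by rw [hi]; exact ⟨rfl, le_rfl⟩)
  have hWo : ∀ b, IsOpen (W b) := fun b => (Slit.isOpen _).preimage (continuous_const.mul hcont)
  have hWp : ∀ b, Pushable (W b) := by
    intro b
    refine hpush r (s b) (hs b) _ fun i w hw _ hwA => ?_
    have e : w = s b * ((s b)⁻¹ * w) := (mul_inv_cancel_left₀ (hs b) w).symm
    generalize (s b)⁻¹ * w = a at e hwA
    subst e
    have : (u * a).im = (u * c i).im := by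
      cases b
      · have hw' : (-u * a).im = (-u * c i).im := hw
        rw [neg_mul, neg_mul, Complex.neg_im, Complex.neg_im] at hw'
        exact neg_injective hw'
      · simpa [s] using hw
    have := hdir a (Or.inl hwA) (c i) (Or.inr ⟨i, rfl⟩) this
    exact hcA i (this ▸ hwA)
  have hWc : ∀ b, IsPathConnected (W b) := fun b =>
    pathConn f hf A₀ hA₀ hA₀c (s b) (hs b) _ (Slit.isOpen _) (Slit.isConnected _)
  have hmt : ∀ v, v ∈ W true ↔ ∀ i, ¬ ((u * eval v f).im = y i ∧ (u * c i).re ≤ (u * eval v f).re) :=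
    fun v => Iff.rfl
  have hmf : ∀ v, v ∈ W false ↔
      ∀ i, ¬ ((u * eval v f).im = y i ∧ (u * eval v f).re ≤ (u * c i).re) := by
    intro v
    have : v ∈ W false ↔ ∀ i, ¬ ((-u * eval v f).im = (-u * c i).im ∧
      (-u * c i).re ≤ (-u * eval v f).re) := Iff.rfl
    rw [this]
    simp only [neg_mul, Complex.neg_im, Complex.neg_re, neg_inj, neg_le_neg_iff, y]
  let R : Option (Fin r) → Set (Fin 2 → ℂ) := fun o =>
    {v | u * eval v f ∈ Complex.im ⁻¹' gap y o}
  have hRW : ∀ v, (∀ b, v ∈ W b) ↔ ∃ o, v ∈ R o := by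
    intro v
    have h1 : (∃ o, v ∈ R o) ↔ ∃ o, (u * eval v f).im ∈ gap y o := Iff.rfl
    rw [h1, ← gap_cover, Bool.forall_bool, hmt, hmf]
    constructor
    · rintro ⟨ha, hb⟩ j hj
      rcases le_total (u * eval v f).re (u * c j).re with h | h
      · exact ha j ⟨hj, h⟩
      · exact hb j ⟨hj, h⟩
    · intro h
      exact ⟨fun i hi => h i hi.1, fun i hi => h i hi.1⟩
  have hRU : ∀ o, R o ⊆ U := fun o v hv => hWU true ((hRW v).2 ⟨o, hv⟩ true)
  have hRc : ∀ o, IsPathConnected (R o) := fun o =>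
    pathConn f hf A₀ hA₀ hA₀c u hu _ ((gap_isOpen y o).preimage Complex.continuous_im)
      ⟨by
        obtain ⟨t, ht⟩ := gap_nonempty y o
        exact ⟨⟨0, t⟩, ht⟩,
      ((gap_convex y o).linear_preimage Complex.imLm).isPreconnected⟩
  have hRo : ∀ o, IsOpen (R o) := fun o =>
    ((gap_isOpen y o).preimage Complex.continuous_im).preimage (continuous_const.mul hcont)
  refine vk (X := U) (fun b => Subtype.val ⁻¹' W b) (fun b => (hWo b).preimage continuous_subtype_val)
    ?_ ?_ (fun o => Subtype.val ⁻¹' R o) (fun o => (hRo o).preimage continuous_subtype_val) ?_ ?_ ?_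
    (fun x => hRW x) x
  · rintro ⟨v, hv⟩
    by_contra hcon
    push Not at hcon
    have h1 : v ∉ W true := hcon true
    have h2 : v ∉ W false := hcon false
    rw [hmt] at h1
    rw [hmf] at h2
    push Not at h1 h2
    obtain ⟨i, hi1, hi2⟩ := h1
    obtain ⟨j, hj1, hj2⟩ := h2
    have hij : i = j := hy (hi1.symm.trans hj1)
    subst hij
    have : u * eval v f = u * c i := Complex.ext (le_antisymm hj2 hi2) hi1
    exact (hUmem v).1 hv i (mul_left_cancel₀ hu this)
  · intro b
    refine ⟨fun a ha b' hb' => ((hWc b).preimage_coe (hWU b)).joinedIn a ha b' hb', ?_⟩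
    intro a b' p q hp hq
    exact push U (W b) (hWU b) (hWp b) a b' p q hp hq
  · intro o
    exact ((hRc o).preimage_coe (hRU o)).nonempty
  · intro o o' x hx hx'
    exact gap_disj y hy o o' _ hx hx'
  · intro o a ha b hb
    exact ((hRc o).preimage_coe (hRU o)).joinedIn a ha b hb
end
end
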